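/- For every n-polytope P and any two points a, b ∈ P, every starring of P at a is equivalent by finitely many elementary moves to every starring of P at b. -/

import Mathlib

open Set MeasureTheory
open scoped Classical
noncomputable section

/-- Ambient Euclidean space `ℝ^N`. -/
abbrev Euc (N : ℕ) := EuclideanSpace ℝ (Fin N)

/-- `s` is an `n`-simplex: the convex hull of `n+1` affinely independent points. -/
def IsSimplex {N : ℕ} (n : ℕ) (s : Set (Euc N)) : Prop :=
  ∃ v : Fin (n + 1) → Euc N, AffineIndependent ℝ v ∧ s = convexHull ℝ (Set.range v)

/-- The (affine) dimension of a set: the rank of its vector span. -/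
def sdim {N : ℕ} (s : Set (Euc N)) : ℕ := Module.finrank ℝ (vectorSpan ℝ s)

/-- A polytope: the compact convex hull of finitely many points (nonempty). -/
def IsPolytope {N : ℕ} (s : Set (Euc N)) : Prop :=
  ∃ t : Finset (Euc N), t.Nonempty ∧ s = convexHull ℝ (t : Set (Euc N))

/-- An `n`-polyhedron: a finite union of `n`-dimensional polytopes. -/
def IsPolyhedron {N : ℕ} (n : ℕ) (P : Set (Euc N)) : Prop :=
  ∃ F : Finset (Set (Euc N)), F.Nonempty ∧ (∀ Q ∈ F, IsPolytope Q ∧ sdim Q = n) ∧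
    (⋃ Q ∈ F, Q) = P

/-- A triangulation of the `n`-dimensional set `P`: a finite set of `n`-simplices with
union `P`, any two distinct ones intersecting in a set of dimension less than `n`. -/
def IsTriangulation {N : ℕ} (n : ℕ) (P : Set (Euc N)) (F : Finset (Set (Euc N))) : Prop :=
  (∀ T ∈ F, IsSimplex n T) ∧ (⋃ T ∈ F, T) = P ∧
    ∀ S ∈ F, ∀ T ∈ F, S ≠ T → sdim (S ∩ T) < n

/-- A starring of `P` at `a`: a triangulation all of whose simplices have a vertex at `a`. -/
def IsStarring {N : ℕ} (n : ℕ) (P : Set (Euc N)) (a : Euc N) (F : Finset (Set (Euc N))) : Prop :=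
  IsTriangulation n P F ∧
    ∀ T ∈ F, ∃ v : Fin (n + 1) → Euc N, AffineIndependent ℝ v ∧
      T = convexHull ℝ (Set.range v) ∧ a ∈ Set.range v

/-- `T` is dissected into the two `n`-simplices `T₁, T₂` by a hyperplane containing an
`(n-2)`-dimensional face of `T`. -/
def IsDissection {N : ℕ} (n : ℕ) (T T₁ T₂ : Set (Euc N)) : Prop :=
  IsSimplex n T₁ ∧ IsSimplex n T₂ ∧ T₁ ∪ T₂ = T ∧ T₁ ≠ T₂ ∧
  ∃ (f : Euc N →ₗ[ℝ] ℝ) (c : ℝ), f ≠ 0 ∧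
    T₁ = T ∩ {x | f x ≤ c} ∧ T₂ = T ∩ {x | c ≤ f x} ∧
    ∃ v : Fin (n + 1) → Euc N, AffineIndependent ℝ v ∧ T = convexHull ℝ (Set.range v) ∧
      ∃ s : Finset (Fin (n + 1)), s.card = n - 1 ∧ ∀ i ∈ s, f (v i) = c

/-- An elementary move: dissect one simplex of the triangulation into two `n`-simplices by a
hyperplane containing an `(n-2)`-face, or merge two simplices whose union is again a simplex. -/
def ElemMove {N : ℕ} (n : ℕ) (F G : Finset (Set (Euc N))) : Prop :=
  (∃ T ∈ F, ∃ T₁ T₂, IsDissection n T T₁ T₂ ∧ G = insert T₁ (insert T₂ (F.erase T))) ∨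
  (∃ T₁ ∈ F, ∃ T₂ ∈ F, T₁ ≠ T₂ ∧ IsSimplex n (T₁ ∪ T₂) ∧
    G = insert (T₁ ∪ T₂) ((F.erase T₁).erase T₂))

/-- Equivalence by finitely many elementary moves. -/
def MoveEquiv {N : ℕ} (n : ℕ) (F G : Finset (Set (Euc N))) : Prop :=
  Relation.ReflTransGen (ElemMove n) F G

/-- `μ` is a valuation on the class `S` of sets. -/
def IsValuation {N : ℕ} (S : Set (Set (Euc N))) (μ : Set (Euc N) → ℝ) : Prop :=
  μ ∅ = 0 ∧ ∀ A ∈ S, ∀ B ∈ S, A ∪ B ∈ S → A ∩ B ∈ S →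
    μ A + μ B = μ (A ∪ B) + μ (A ∩ B)

/-- `𝒯ⁿ`: simplices of dimension at most `n` (together with `∅`). -/
def simplexClass (N n : ℕ) : Set (Set (Euc N)) :=
  {s | s = ∅ ∨ ∃ k ≤ n, IsSimplex k s}

/-- `𝒫ⁿ`: polytopes of dimension at most `n` (together with `∅`). -/
def polytopeClass (N n : ℕ) : Set (Set (Euc N)) :=
  {s | s = ∅ ∨ (IsPolytope s ∧ sdim s ≤ n)}

/-- `𝒬ⁿ`: polyhedra (finite unions of polytopes) of dimension at most `n` (with `∅`). -/
def polyhedronClass (N n : ℕ) : Set (Set (Euc N)) :=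
  {s | s = ∅ ∨ ((∃ F : Finset (Set (Euc N)), F.Nonempty ∧ (∀ Q ∈ F, IsPolytope Q) ∧
      (⋃ Q ∈ F, Q) = s) ∧ sdim s ≤ n)}



abbrev hull {n : ℕ} (T : Finset (Euc n)) : Set (Euc n) := convexHull ℝ (T : Set (Euc n))

def Smp {n : ℕ} (T : Finset (Euc n)) : Prop :=
  AffineIndependent ℝ ((↑) : T → Euc n) ∧ T.card = n + 1

def Smp.basis {n : ℕ} {T : Finset (Euc n)} (h : Smp T) : AffineBasis T ℝ (Euc n) :=
  ⟨((↑) : T → Euc n), h.1, by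
    rw [h.1.affineSpan_eq_top_iff_card_eq_finrank_add_one]
    simp [h.2]⟩

def co {n : ℕ} (T : Finset (Euc n)) (v : Euc n) : Euc n →ᵃ[ℝ] ℝ :=
  if h : Smp T ∧ v ∈ T then h.1.basis.coord ⟨v, h.2⟩ else 0

lemma co_eq {n : ℕ} {T : Finset (Euc n)} (h : Smp T) (v : T) :
    co T v = h.basis.coord v := by
  unfold co
  rw [dif_pos ⟨h, v.2⟩]

lemma co_self {n : ℕ} {T : Finset (Euc n)} (h : Smp T) {v : Euc n} (hv : v ∈ T) :
    co T v v = 1 := by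
  have := co_eq h ⟨v, hv⟩
  simp only at this
  rw [this]
  exact h.basis.coord_apply_eq ⟨v, hv⟩

lemma co_ne {n : ℕ} {T : Finset (Euc n)} (h : Smp T) {v u : Euc n} (hv : v ∈ T) (hu : u ∈ T)
    (huv : u ≠ v) : co T v u = 0 := by
  have := co_eq h ⟨v, hv⟩
  simp only at this
  rw [this]
  refine h.basis.coord_apply_ne (i := ⟨v, hv⟩) (j := ⟨u, hu⟩) ?_
  simpa using huv.symm

lemma co_sum {n : ℕ} {T : Finset (Euc n)} (h : Smp T) (x : Euc n) :
    ∑ v ∈ T, co T v x = 1 := by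
  rw [← Finset.sum_coe_sort, ← h.basis.sum_coord_apply_eq_one x]
  exact Finset.sum_congr rfl fun v _ => by rw [co_eq h v]

lemma co_comb {n : ℕ} {T : Finset (Euc n)} (h : Smp T) (x : Euc n) :
    ∑ v ∈ T, co T v x • v = x := by
  conv_rhs => rw [← h.basis.linear_combination_coord_eq_self x]
  rw [← Finset.sum_coe_sort]
  exact Finset.sum_congr rfl fun v _ => by rw [co_eq h v]; rfl

lemma aff_comb {n : ℕ} (h : Euc n →ᵃ[ℝ] ℝ) (s : Finset (Euc n)) (w : Euc n → ℝ)
    (hw : ∑ v ∈ s, w v = 1) : h (∑ v ∈ s, w v • v) = ∑ v ∈ s, w v * h v := by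
  rw [AffineMap.decomp h]
  simp only [Pi.add_apply, map_sum, map_smul, smul_eq_mul, mul_add, Finset.sum_add_distrib,
    ← Finset.sum_mul, hw, one_mul]

lemma aff_eq {n : ℕ} {T : Finset (Euc n)} (hT : Smp T) (h : Euc n →ᵃ[ℝ] ℝ) (x : Euc n) :
    h x = ∑ v ∈ T, co T v x * h v := by
  conv_lhs => rw [← co_comb hT x]
  exact aff_comb h T _ (co_sum hT x)

lemma aff_ext {n : ℕ} {T : Finset (Euc n)} (hT : Smp T) {h g : Euc n →ᵃ[ℝ] ℝ}
    (hg : ∀ v ∈ T, h v = g v) : h = g := by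
  ext x
  rw [aff_eq hT h, aff_eq hT g]
  exact Finset.sum_congr rfl fun v hv => by rw [hg v hv]

lemma mem_hull {n : ℕ} {T : Finset (Euc n)} (h : Smp T) {x : Euc n} :
    x ∈ hull T ↔ ∀ v ∈ T, 0 ≤ co T v x := by
  have := h.basis.convexHull_eq_nonneg_coord
  have h2 : Set.range h.basis = (T : Set (Euc n)) := by
    show Set.range ((↑) : T → Euc n) = _
    simp
  rw [h2] at this
  rw [hull, this]
  constructor
  · intro hx v hv
    have := hx ⟨v, hv⟩
    rwa [← co_eq h] at this
  · intro hx v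
    rw [← co_eq h]
    exact hx v v.2

lemma co_cont {n : ℕ} (h : Euc n →ᵃ[ℝ] ℝ) : Continuous h := h.continuous_of_finiteDimensional

lemma smp_of_dual {n : ℕ} {T : Finset (Euc n)} (hc : T.card = n + 1)
    (h : Euc n → (Euc n →ᵃ[ℝ] ℝ)) (h1 : ∀ v ∈ T, h v v = 1)
    (h0 : ∀ v ∈ T, ∀ u ∈ T, u ≠ v → h v u = 0) : Smp T := by
  refine ⟨?_, hc⟩
  rw [affineIndependent_iff]
  intro s w hw hs i hi
  have key : ∑ e ∈ s, w e * h i (e : Euc n) = 0 := by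
    have h2 : ∀ e : T, h i (e : Euc n) = (h i).linear e + h i 0 := fun e => by
      conv_lhs => rw [AffineMap.decomp (h i)]
      rfl
    simp only [h2, mul_add, Finset.sum_add_distrib, ← Finset.sum_mul, hw, zero_mul, add_zero]
    have := congrArg (h i).linear hs
    simpa using this
  rw [Finset.sum_eq_single i] at key
  · rwa [h1 i i.2, mul_one] at key
  · intro b _ hb
    rw [h0 i i.2 b b.2 (fun h => hb (Subtype.ext h)), mul_zero]
  · intro h; exact absurd hi h

lemma co_unique {n : ℕ} {T : Finset (Euc n)} (hT : Smp T) {v : Euc n} (hv : v ∈ T)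
    {h : Euc n →ᵃ[ℝ] ℝ} (h1 : h v = 1) (h0 : ∀ u ∈ T, u ≠ v → h u = 0) : co T v = h := by
  apply aff_ext hT
  intro u hu
  by_cases huv : u = v
  · subst huv; rw [co_self hT hu, h1]
  · rw [co_ne hT hv hu huv, h0 u hu huv]

/-- replacement of vertex `v` by `x` -/
abbrev rep {n : ℕ} (T : Finset (Euc n)) (v x : Euc n) : Finset (Euc n) := insert x (T.erase v)

lemma rep_notMem {n : ℕ} {T : Finset (Euc n)} (hT : Smp T) {v x : Euc n} (hv : v ∈ T)
    (hx : co T v x ≠ 0) : x ∉ T.erase v := by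
  intro h
  exact hx (co_ne hT hv (Finset.mem_of_mem_erase h) (Finset.ne_of_mem_erase h))

lemma rep_smp {n : ℕ} {T : Finset (Euc n)} (hT : Smp T) {v x : Euc n} (hv : v ∈ T)
    (hx : co T v x ≠ 0) : Smp (rep T v x) := by
  have hx' := rep_notMem hT hv hx
  apply smp_of_dual (h := fun u => if u = x then (co T v x)⁻¹ • co T v else
    co T u - (co T u x / co T v x) • co T v)
  · rw [Finset.card_insert_of_notMem hx', Finset.card_erase_of_mem hv, hT.2]; rfl
  · intro u hu
    rcases Finset.mem_insert.1 hu with rfl | hu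
    · simp [hx]
    · have : u ≠ x := fun h => hx' (h ▸ hu)
      have hu1 := Finset.mem_of_mem_erase hu
      have hu2 := Finset.ne_of_mem_erase hu
      simp [this, co_self hT hu1, co_ne hT hv hu1 hu2]
  · intro u hu y hy hyu
    rcases Finset.mem_insert.1 hu with rfl | hu
    · rcases Finset.mem_insert.1 hy with rfl | hy
      · exact absurd rfl hyu
      · simp [co_ne hT hv (Finset.mem_of_mem_erase hy) (Finset.ne_of_mem_erase hy)]
    · have : u ≠ x := fun h => hx' (h ▸ hu)
      have hu1 := Finset.mem_of_mem_erase hu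
      have hu2 := Finset.ne_of_mem_erase hu
      rcases Finset.mem_insert.1 hy with rfl | hy
      · simp [this, hx]
      · have hy1 := Finset.mem_of_mem_erase hy
        have hy2 := Finset.ne_of_mem_erase hy
        simp [this, co_ne hT hv hy1 hy2, co_ne hT hu1 hy1 hyu]

lemma co_rep_new {n : ℕ} {T : Finset (Euc n)} (hT : Smp T) {v x : Euc n} (hv : v ∈ T)
    (hx : co T v x ≠ 0) (y : Euc n) : co (rep T v x) x y = co T v y / co T v x := by
  have : co (rep T v x) x = (co T v x)⁻¹ • co T v := by
    apply co_unique (rep_smp hT hv hx) (by simp)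
    · simp [hx]
    · intro u hu hux
      rcases Finset.mem_insert.1 hu with rfl | hu
      · exact absurd rfl hux
      · simp [co_ne hT hv (Finset.mem_of_mem_erase hu) (Finset.ne_of_mem_erase hu)]
  rw [this]
  simp
  ring

lemma co_rep_old {n : ℕ} {T : Finset (Euc n)} (hT : Smp T) {v x : Euc n} (hv : v ∈ T)
    (hx : co T v x ≠ 0) {u : Euc n} (hu : u ∈ T.erase v) (y : Euc n) :
    co (rep T v x) u y = co T u y - co T u x / co T v x * co T v y := by
  have hx' := rep_notMem hT hv hx
  have hu1 := Finset.mem_of_mem_erase hu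
  have hu2 := Finset.ne_of_mem_erase hu
  have : co (rep T v x) u = co T u - (co T u x / co T v x) • co T v := by
    apply co_unique (rep_smp hT hv hx) (by simp [hu1, hu2])
    · simp [co_self hT hu1, co_ne hT hv hu1 hu2]
    · intro z hz hzu
      rcases Finset.mem_insert.1 hz with rfl | hz
      · simp [hx]
      · have hy1 := Finset.mem_of_mem_erase hz
        have hy2 := Finset.ne_of_mem_erase hz
        simp [co_ne hT hv hy1 hy2, co_ne hT hu1 hy1 hzu]
  rw [this]
  simp

inductive Step {n : ℕ} : Multiset (Finset (Euc n)) → Multiset (Finset (Euc n)) → Prop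
  | mk (K : Multiset (Finset (Euc n))) (T : Finset (Euc n)) (p q x : Euc n) (t : ℝ)
      (hT : Smp T) (hp : p ∈ T) (hq : q ∈ T) (hpq : p ≠ q) (h0 : 0 < t) (h1 : t < 1)
      (hx : x = (1 - t) • p + t • q) : Step (T ::ₘ K) (rep T p x ::ₘ rep T q x ::ₘ K)

def Eqv {n : ℕ} (M M' : Multiset (Finset (Euc n))) : Prop := Relation.EqvGen Step M M'

lemma Eqv.refl {n : ℕ} (M : Multiset (Finset (Euc n))) : Eqv M M := Relation.EqvGen.refl M

lemma Eqv.of_eq {n : ℕ} {M M' : Multiset (Finset (Euc n))} (h : M = M') : Eqv M M' :=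
  h ▸ Eqv.refl M

lemma Eqv.symm {n : ℕ} {M M' : Multiset (Finset (Euc n))} (h : Eqv M M') : Eqv M' M :=
  Relation.EqvGen.symm _ _ h

lemma Eqv.trans {n : ℕ} {M M' M'' : Multiset (Finset (Euc n))} (h : Eqv M M') (h' : Eqv M' M'') :
    Eqv M M'' := Relation.EqvGen.trans _ _ _ h h'

lemma Eqv.add_left {n : ℕ} {M M' : Multiset (Finset (Euc n))} (L : Multiset (Finset (Euc n)))
    (h : Eqv M M') : Eqv (L + M) (L + M') := by
  induction h with
  | rel x y h =>
    apply Relation.EqvGen.rel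
    obtain ⟨K, T, p, q, x, t, hT, hp, hq, hpq, h0, h1, hx⟩ := h
    rw [Multiset.add_cons, Multiset.add_cons, Multiset.add_cons]
    exact Step.mk (L + K) T p q x t hT hp hq hpq h0 h1 hx
  | refl x => exact Eqv.refl _
  | symm x y _ ih => exact ih.symm
  | trans x y z _ _ ih1 ih2 => exact ih1.trans ih2

lemma Eqv.add {n : ℕ} {M M' L L' : Multiset (Finset (Euc n))}
    (h : Eqv M M') (h' : Eqv L L') : Eqv (M + L) (M' + L') := by
  refine (h'.add_left M).trans ?_
  rw [add_comm M, add_comm M']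
  exact h.add_left L'

lemma Eqv.sum {n : ℕ} {ι : Type*} (s : Finset ι) {f g : ι → Multiset (Finset (Euc n))}
    (h : ∀ i ∈ s, Eqv (f i) (g i)) : Eqv (∑ i ∈ s, f i) (∑ i ∈ s, g i) := by
  induction s using Finset.induction_on with
  | empty => simpa using Eqv.refl _
  | insert a s ha ih =>
    rw [Finset.sum_insert ha, Finset.sum_insert ha]
    exact (h a (by simp)).add (ih fun i hi => h i (by simp [hi]))

lemma Eqv.step {n : ℕ} {T : Finset (Euc n)} {p q x : Euc n} {t : ℝ}
    (hT : Smp T) (hp : p ∈ T) (hq : q ∈ T) (hpq : p ≠ q) (h0 : 0 < t) (h1 : t < 1)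
    (hx : x = (1 - t) • p + t • q) : Eqv {T} ({rep T p x} + {rep T q x}) :=
  Relation.EqvGen.rel _ _ (Step.mk 0 T p q x t hT hp hq hpq h0 h1 hx)

lemma co_of_comb {n : ℕ} {T k : Finset (Euc n)} (hT : Smp T) (hk : k ⊆ T) {w : Euc n → ℝ}
    (hw : ∑ v ∈ k, w v = 1) {v : Euc n} (hv : v ∈ T) :
    co T v (∑ u ∈ k, w u • u) = if v ∈ k then w v else 0 := by
  rw [aff_comb _ _ _ hw]
  have : ∀ u ∈ k, w u * co T v u = if u = v then w v else 0 := by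
    intro u hu
    split_ifs with h
    · subst h; rw [co_self hT hv, mul_one]
    · rw [co_ne hT hv (hk hu) h, mul_zero]
  rw [Finset.sum_congr rfl this, Finset.sum_ite_eq']

lemma stellar {n : ℕ} (k : Finset (Euc n)) : ∀ (T : Finset (Euc n)) (_ : Smp T) (_ : k ⊆ T)
    (w : Euc n → ℝ) (_ : ∀ v ∈ k, 0 < w v) (_ : ∑ v ∈ k, w v = 1) (x : Euc n)
    (_ : x = ∑ v ∈ k, w v • v), Eqv {T} (∑ v ∈ k, {rep T v x}) := by
  induction k using Finset.induction_on with
  | empty => intro T hT hk w hw h1; simp at h1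
  | insert p k hp ih =>
    intro T hT hk w hw h1 x hx
    have hpT : p ∈ T := hk (by simp)
    have hkT : k ⊆ T := fun v hv => hk (by simp [hv])
    rw [Finset.sum_insert hp] at h1 hx ⊢
    rcases k.eq_empty_or_nonempty with rfl | hne
    · simp at h1 hx ⊢
      rw [h1, one_smul] at hx
      rw [hx, rep, Finset.insert_erase hpT]
      exact Eqv.refl _
    have hwp := hw p (by simp)
    have hwk : 0 < ∑ v ∈ k, w v := Finset.sum_pos (fun v hv => hw v (by simp [hv])) hne
    have hs : ∑ v ∈ k, w v = 1 - w p := by linarith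
    have hs0 : 0 < 1 - w p := by linarith
    set w' : Euc n → ℝ := fun v => w v / (1 - w p) with hw'
    have hw'1 : ∑ v ∈ k, w' v = 1 := by
      rw [hw', ← Finset.sum_div, hs, div_self hs0.ne']
    have hw'0 : ∀ v ∈ k, 0 < w' v := fun v hv => div_pos (hw v (by simp [hv])) hs0
    set x' := ∑ v ∈ k, w' v • v with hx'
    have hxx : x = (1 - (1 - w p)) • p + (1 - w p) • x' := by
      rw [hx, hx', Finset.smul_sum]
      congr 1
      · simp
      · refine Finset.sum_congr rfl fun v _ => ?_
        rw [smul_smul, hw']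
        congr 1
        field_simp
    have hcx : ∀ v ∈ T, co T v x' = if v ∈ k then w' v else 0 := fun v hv =>
      co_of_comb hT hkT hw'1 hv
    have hcp : co T p x' = 0 := by rw [hcx p hpT, if_neg hp]
    have hcpx : co T p x = w p := by
      rw [hx, ← Finset.sum_insert (f := fun v => w v • v) hp,
        co_of_comb hT hk (by rw [Finset.sum_insert hp, h1]) hpT]
      simp
    have hTp : Smp (rep T p x) := rep_smp hT hpT (by rw [hcpx]; exact hwp.ne')
    have hxn : x ∉ T.erase p := rep_notMem hT hpT (by rw [hcpx]; exact hwp.ne')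
    have hkp : k ⊆ T.erase p := fun v hv => Finset.mem_erase.2 ⟨fun h => hp (h ▸ hv), hkT hv⟩
    have e1 := ih T hT hkT w' hw'0 hw'1 x' rfl
    have e2 := ih (rep T p x) hTp (hkp.trans (Finset.subset_insert _ _)) w' hw'0 hw'1 x' rfl
    have e3 : Eqv (∑ v ∈ k, {rep T v x'})
        (∑ v ∈ k, ({rep (rep T p x) v x'} + {rep T v x})) := by
      refine Eqv.sum k fun v hv => ?_
      have hvT := hkT hv
      have hvp : v ≠ p := fun h => hp (h ▸ hv)
      have hc : co T v x' ≠ 0 := by rw [hcx v hvT, if_pos hv]; exact (hw'0 v hv).ne'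
      have hTv := rep_smp hT hvT hc
      have hx'n := rep_notMem hT hvT hc
      have hpx' : p ≠ x' := by
        intro h; rw [← h, co_self hT hpT] at hcp; exact one_ne_zero hcp
      have hvx : x ≠ v := by
        intro h; exact hxn (h ▸ hkp hv)
      have := Eqv.step (p := p) (q := x') (x := x) hTv (by simp [hvp.symm, hpT]) (by simp) hpx' hs0
        (by linarith) hxx
      refine this.trans (Eqv.of_eq ?_)
      congr 2
      · rw [rep, rep, rep, rep, Finset.erase_insert_of_ne hpx'.symm, Finset.erase_insert_of_ne hvx,
          Finset.insert_comm, Finset.erase_right_comm]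
      · rw [rep, rep, rep, Finset.erase_insert hx'n]
    rw [Finset.sum_add_distrib] at e3
    refine (e1.trans e3).trans ?_
    exact Eqv.add e2.symm (Eqv.refl _)

lemma flipE {n : ℕ} {T : Finset (Euc n)} (hT : Smp T) (a : Euc n) :
    Eqv ({T} + ∑ v ∈ T.filter (fun v => co T v a < 0), {rep T v a})
      (∑ v ∈ T.filter (fun v => 0 < co T v a), {rep T v a}) := by
  set I := T.filter (fun v => 0 < co T v a) with hI
  set J := T.filter (fun v => co T v a < 0) with hJ
  have hIT : I ⊆ T := Finset.filter_subset _ _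
  have hJT : J ⊆ T := Finset.filter_subset _ _
  have hIJ : ∀ (M : Type) [AddCommMonoid M] (f : Euc n → M), (∀ v ∈ T, co T v a = 0 → f v = 0) →
      ∑ v ∈ T, f v = ∑ v ∈ I, f v + ∑ v ∈ J, f v := by
    intro M _ f hf
    rw [← Finset.sum_union]
    · symm
      apply Finset.sum_subset
      · exact Finset.union_subset hIT hJT
      · intro v hv hv'
        apply hf v hv
        simp only [hI, hJ, Finset.mem_union, Finset.mem_filter, hv, true_and, not_or, not_lt] at hv'
        exact le_antisymm hv'.1 hv'.2
    · rw [Finset.disjoint_left]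
      intro v h1 h2
      exact lt_asymm (Finset.mem_filter.1 h1).2 (Finset.mem_filter.1 h2).2
  have hs1 := hIJ ℝ (fun v => co T v a) (fun v _ h => h)
  have hs2 := hIJ (Euc n) (fun v => co T v a • v) (fun v _ h => by simp [h])
  rw [co_sum hT] at hs1
  rw [co_comb hT] at hs2
  have hIpos : ∀ v ∈ I, 0 < co T v a := fun v hv => (Finset.mem_filter.1 hv).2
  have hJneg : ∀ v ∈ J, co T v a < 0 := fun v hv => (Finset.mem_filter.1 hv).2
  set s := ∑ v ∈ I, co T v a with hs
  have hJs : ∑ v ∈ J, co T v a = 1 - s := by linarith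
  have hs0 : 0 < s := by
    have : ∑ v ∈ J, co T v a ≤ 0 := Finset.sum_nonpos fun v hv => (hJneg v hv).le
    linarith
  set w : Euc n → ℝ := fun v => co T v a / s with hw
  set c := ∑ v ∈ I, w v • v with hc
  have hw1 : ∑ v ∈ I, w v = 1 := by rw [hw, ← Finset.sum_div, div_self hs0.ne']
  have hw0 : ∀ v ∈ I, 0 < w v := fun v hv => div_pos (hIpos v hv) hs0
  have haJ : a ∉ J := by
    intro h
    have := hJneg a h
    rw [co_self hT (hJT h)] at this
    linarith
  -- weights on insert a J
  set w2 : Euc n → ℝ := fun v => if v = a then 1 / s else - co T v a / s with hw2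
  have hw2J : ∀ v ∈ J, w2 v = - co T v a / s := fun v hv => by
    simp only [hw2]; rw [if_neg]; rintro rfl; exact haJ hv
  have hw21 : ∑ v ∈ insert a J, w2 v = 1 := by
    rw [Finset.sum_insert haJ, Finset.sum_congr rfl hw2J, ← Finset.sum_div, Finset.sum_neg_distrib,
      hJs]
    simp only [hw2, if_true]
    field_simp
    ring
  have hw20 : ∀ v ∈ insert a J, 0 < w2 v := by
    intro v hv
    rcases Finset.mem_insert.1 hv with rfl | hv
    · simp [hw2, hs0]
    · rw [hw2J v hv]; exact div_pos (by linarith [hJneg v hv]) hs0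
  have hc2 : c = ∑ v ∈ insert a J, w2 v • v := by
    rw [Finset.sum_insert haJ, Finset.sum_congr rfl (fun v hv => by rw [hw2J v hv])]
    have e1 : c = s⁻¹ • ∑ v ∈ I, co T v a • v := by
      rw [hc, Finset.smul_sum]
      refine Finset.sum_congr rfl fun v _ => ?_
      rw [smul_smul, hw]; congr 1; ring
    have e2 : ∑ v ∈ J, (- co T v a / s) • v = - (s⁻¹ • ∑ v ∈ J, co T v a • v) := by
      rw [Finset.smul_sum, ← Finset.sum_neg_distrib]
      refine Finset.sum_congr rfl fun v _ => ?_
      rw [smul_smul, ← neg_smul]; congr 1; ring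
    have e3 : w2 a = s⁻¹ := by simp [hw2]
    have e4 : ∑ v ∈ I, co T v a • v = a - ∑ v ∈ J, co T v a • v := by
      rw [eq_sub_iff_add_eq]; exact hs2.symm
    rw [e1, e2, e3, e4, smul_sub, sub_eq_add_neg]
  have A1 := stellar I T hT hIT w hw0 hw1 c rfl
  have A2 : Eqv (∑ v ∈ J, {rep T v a}) (∑ j ∈ J, ∑ i ∈ I, {rep (rep T j a) i c}) := by
    refine Eqv.sum J fun j hj => ?_
    refine stellar I (rep T j a) (rep_smp hT (hJT hj) (hJneg j hj).ne) ?_ w hw0 hw1 c rfl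
    intro i hi
    refine Finset.mem_insert_of_mem (Finset.mem_erase.2 ⟨?_, hIT hi⟩)
    rintro rfl
    exact lt_asymm (hIpos _ hi) (hJneg _ hj)
  have A3 : Eqv (∑ v ∈ I, {rep T v a}) (∑ i ∈ I, ({rep T i c} + ∑ j ∈ J, {rep (rep T j a) i c})) := by
    refine Eqv.sum I fun i hi => ?_
    have hTi := rep_smp hT (hIT hi) (hIpos i hi).ne'
    have hai := rep_notMem hT (hIT hi) (hIpos i hi).ne'
    have := stellar (insert a J) (rep T i a) hTi ?_ w2 hw20 hw21 c hc2
    · refine this.trans (Eqv.of_eq ?_)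
      rw [Finset.sum_insert haJ]
      congr 1
      · rw [rep, rep, rep, Finset.erase_insert hai]
      · refine Finset.sum_congr rfl fun j hj => ?_
        have hij : i ≠ j := by
          rintro rfl
          exact lt_asymm (hIpos _ hi) (hJneg _ hj)
        have haj : a ≠ j := by rintro rfl; exact haJ hj
        by_cases hai' : a = i
        · exfalso
          have h0 : co T j a = 0 := by rw [hai']; exact co_ne hT (hJT hj) (hIT hi) hij
          linarith [hJneg j hj]
        · rw [rep, rep, rep, rep, Finset.erase_insert_of_ne haj, Finset.erase_insert_of_ne hai',
            Finset.erase_right_comm]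
    · intro v hv
      rcases Finset.mem_insert.1 hv with rfl | hv
      · simp
      · refine Finset.mem_insert_of_mem (Finset.mem_erase.2 ⟨?_, hJT hv⟩)
        rintro rfl
        exact lt_asymm (hIpos _ hi) (hJneg _ hv)
  refine (Eqv.add A1 A2).trans ?_
  refine Eqv.trans (Eqv.of_eq ?_) A3.symm
  rw [Finset.sum_add_distrib, Finset.sum_comm]

lemma co_seg {n : ℕ} {T : Finset (Euc n)} {p q x : Euc n} {t : ℝ}
    (hx : x = (1 - t) • p + t • q) (h : Euc n →ᵃ[ℝ] ℝ) : h x = (1 - t) * h p + t * h q := by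
  have : x = AffineMap.lineMap p q t := by
    rw [AffineMap.lineMap_apply_module, hx]
  rw [this, AffineMap.apply_lineMap, AffineMap.lineMap_apply_module]
  simp

lemma co_nonneg {n : ℕ} {T : Finset (Euc n)} (hT : Smp T) {x : Euc n} (hx : x ∈ hull T)
    {h : Euc n →ᵃ[ℝ] ℝ} (hh : ∀ v ∈ T, 0 ≤ h v) : 0 ≤ h x := by
  rw [aff_eq hT h x]
  exact Finset.sum_nonneg fun v hv => mul_nonneg ((mem_hull hT).1 hx v hv) (hh v hv)

lemma co_nonpos {n : ℕ} {T : Finset (Euc n)} (hT : Smp T) {x : Euc n} (hx : x ∈ hull T)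
    {h : Euc n →ᵃ[ℝ] ℝ} (hh : ∀ v ∈ T, h v ≤ 0) : h x ≤ 0 := by
  rw [aff_eq hT h x]
  exact Finset.sum_nonpos fun v hv =>
    mul_nonpos_of_nonneg_of_nonpos ((mem_hull hT).1 hx v hv) (hh v hv)

/-- the separating function of an edge split; negative at `p`, positive at `q` -/
def sepf {n : ℕ} (T : Finset (Euc n)) (p q : Euc n) (t : ℝ) : Euc n →ᵃ[ℝ] ℝ :=
  (1 - t) • co T q - t • co T p

lemma sepf_apply {n : ℕ} (T : Finset (Euc n)) (p q : Euc n) (t : ℝ) (y : Euc n) :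
    sepf T p q t y = (1 - t) * co T q y - t * co T p y := by
  simp [sepf]

lemma split_hull {n : ℕ} {T : Finset (Euc n)} {p q x : Euc n} {t : ℝ}
    (hT : Smp T) (hp : p ∈ T) (hq : q ∈ T) (hpq : p ≠ q) (h0 : 0 < t) (h1 : t < 1)
    (hx : x = (1 - t) • p + t • q) :
    Smp (rep T q x) ∧ hull (rep T q x) = hull T ∩ {y | sepf T p q t y ≤ 0} := by
  have cq : co T q x = t := by
    rw [co_seg (T := T) hx, co_ne hT hq hp hpq, co_self hT hq]; ring
  have cp : co T p x = 1 - t := by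
    rw [co_seg (T := T) hx, co_ne hT hp hq hpq.symm, co_self hT hp]; ring
  have cu : ∀ u ∈ T, u ≠ p → u ≠ q → co T u x = 0 := by
    intro u hu h1 h2
    rw [co_seg (T := T) hx, co_ne hT hu hp h1.symm, co_ne hT hu hq h2.symm]; ring
  have hcq : co T q x ≠ 0 := by rw [cq]; exact h0.ne'
  have hR := rep_smp hT hq hcq
  refine ⟨hR, ?_⟩
  ext y
  simp only [Set.mem_inter_iff, Set.mem_setOf_eq, mem_hull hR, mem_hull hT, sepf_apply]
  have cop : co (rep T q x) p y = co T p y - (1 - t) / t * co T q y := by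
    rw [co_rep_old hT hq hcq (Finset.mem_erase.2 ⟨hpq, hp⟩), cp, cq]
  have cox : co (rep T q x) x y = co T q y / t := by rw [co_rep_new hT hq hcq, cq]
  have cou : ∀ u ∈ T, u ≠ p → u ≠ q → co (rep T q x) u y = co T u y := by
    intro u hu h1 h2
    rw [co_rep_old hT hq hcq (Finset.mem_erase.2 ⟨h2, hu⟩), cu u hu h1 h2]; ring
  have key : (1 - t) * co T q y - t * co T p y = - t * co (rep T q x) p y := by
    rw [cop]; field_simp; ring
  constructor
  · intro h
    have hq' : 0 ≤ co T q y := by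
      have := h x (by simp)
      rw [cox] at this
      rwa [le_div_iff₀ h0, zero_mul] at this
    have hp' : 0 ≤ co (rep T q x) p y := h p (by simp [hpq, hp])
    refine ⟨fun v hv => ?_, by rw [key]; nlinarith⟩
    by_cases e1 : v = q
    · rw [e1]; exact hq'
    by_cases e2 : v = p
    · rw [e2]
      have : co T p y = co (rep T q x) p y + (1 - t) / t * co T q y := by rw [cop]; ring
      rw [this]
      have : 0 ≤ (1 - t) / t := div_nonneg (by linarith) h0.le
      positivity
    · rw [← cou v hv e2 e1]; exact h v (by simp [e1, hv])
  · rintro ⟨h, h'⟩ v hv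
    rw [key] at h'
    rcases Finset.mem_insert.1 hv with rfl | hv
    · rw [cox]; exact div_nonneg (h q hq) h0.le
    · have hv1 := Finset.mem_of_mem_erase hv
      have hv2 := Finset.ne_of_mem_erase hv
      by_cases e2 : v = p
      · rw [e2]; nlinarith
      · rw [cou v hv1 e2 hv2]; exact h v hv1

lemma split_hull' {n : ℕ} {T : Finset (Euc n)} {p q x : Euc n} {t : ℝ}
    (hT : Smp T) (hp : p ∈ T) (hq : q ∈ T) (hpq : p ≠ q) (h0 : 0 < t) (h1 : t < 1)
    (hx : x = (1 - t) • p + t • q) :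
    Smp (rep T p x) ∧ hull (rep T p x) = hull T ∩ {y | 0 ≤ sepf T p q t y} := by
  have := split_hull (p := q) (q := p) (x := x) (t := 1 - t) hT hq hp hpq.symm (by linarith)
    (by linarith) (by rw [hx, add_comm]; simp)
  refine ⟨this.1, ?_⟩
  rw [this.2]
  ext y
  simp only [Set.mem_inter_iff, Set.mem_setOf_eq, sepf_apply]
  constructor <;> rintro ⟨h, h'⟩ <;> refine ⟨h, ?_⟩ <;> linarith

lemma sepf_ne {n : ℕ} {T : Finset (Euc n)} {p q : Euc n} {t : ℝ}
    (hT : Smp T) (hp : p ∈ T) (hq : q ∈ T) (hpq : p ≠ q) (h0 : 0 < t) :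
    sepf T p q t ≠ 0 := by
  intro h
  have := sepf_apply T p q t p
  rw [h, co_self hT hp, co_ne hT hq hp hpq] at this
  simp at this
  linarith

lemma ae_ne {n : ℕ} {h : Euc n →ᵃ[ℝ] ℝ} (hh : h ≠ 0) : ∀ᵐ x : Euc n, h x ≠ 0 := by
  set s : AffineSubspace ℝ (Euc n) := (AffineSubspace.mk' (0:ℝ) ⊥).comap h with hs
  have hmem : ∀ x, x ∈ s ↔ h x = 0 := by
    intro x
    simp [hs, AffineSubspace.mem_mk']
  have : s ≠ ⊤ := by
    intro ht
    apply hh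
    ext x
    have : x ∈ s := by rw [ht]; trivial
    simpa using (hmem x).1 this
  have h2 := Measure.addHaar_affineSubspace volume s this
  rw [ae_iff]
  convert h2 using 2
  ext x
  simp [hmem x]

def cnt {n : ℕ} (M : Multiset (Finset (Euc n))) (x : Euc n) : ℕ :=
  M.countP (fun T => x ∈ hull T)

lemma cnt_add {n : ℕ} (M L : Multiset (Finset (Euc n))) (x : Euc n) :
    cnt (M + L) x = cnt M x + cnt L x := Multiset.countP_add _ _ _

lemma cnt_cons {n : ℕ} (T : Finset (Euc n)) (M : Multiset (Finset (Euc n))) (x : Euc n) :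
    cnt (T ::ₘ M) x = cnt M x + if x ∈ hull T then 1 else 0 := Multiset.countP_cons _ _ _

lemma cnt_single {n : ℕ} (T : Finset (Euc n)) (x : Euc n) :
    cnt {T} x = if x ∈ hull T then 1 else 0 := by
  have := cnt_cons T 0 x
  simpa [cnt] using this

lemma cnt_sum {n : ℕ} {ι : Type*} (s : Finset ι) (f : ι → Finset (Euc n)) (x : Euc n) :
    cnt (∑ i ∈ s, {f i}) x = ∑ i ∈ s, if x ∈ hull (f i) then 1 else 0 := by
  induction s using Finset.induction_on with
  | empty => simp [cnt]
  | insert a s ha ih => rw [Finset.sum_insert ha, Finset.sum_insert ha, cnt_add, cnt_single, ih]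

lemma cnt_pos {n : ℕ} {M : Multiset (Finset (Euc n))} {x : Euc n} :
    0 < cnt M x ↔ ∃ T ∈ M, x ∈ hull T := Multiset.countP_pos

lemma cnt_eqv {n : ℕ} {M M' : Multiset (Finset (Euc n))} (h : Eqv M M') :
    ∀ᵐ x : Euc n, cnt M x = cnt M' x := by
  induction h with
  | rel x y h =>
    obtain ⟨K, T, p, q, x, t, hT, hp, hq, hpq, h0, h1, hx⟩ := h
    filter_upwards [ae_ne (sepf_ne hT hp hq hpq h0)] with y hy
    rw [cnt_cons, cnt_cons, cnt_cons, (split_hull hT hp hq hpq h0 h1 hx).2,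
      (split_hull' hT hp hq hpq h0 h1 hx).2]
    simp only [Set.mem_inter_iff, Set.mem_setOf_eq]
    rcases lt_or_gt_of_ne hy with h | h
    · have h2 := h.le
      have h3 := not_le.2 h
      by_cases hh : y ∈ hull T <;> simp [h2, h3, hh]
    · have h2 := h.le
      have h3 := not_le.2 h
      by_cases hh : y ∈ hull T <;> simp [h2, h3, hh]
  | refl x => exact Filter.Eventually.of_forall fun _ => rfl
  | symm x y _ ih => filter_upwards [ih] with x hx using hx.symm
  | trans x y z _ _ ih1 ih2 => filter_upwards [ih1, ih2] with x h1 h2 using h1.trans h2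

lemma smp_eqv {n : ℕ} {M M' : Multiset (Finset (Euc n))} (h : Eqv M M') :
    (∀ T ∈ M, Smp T) ↔ (∀ T ∈ M', Smp T) := by
  induction h with
  | rel x y h =>
    obtain ⟨K, T, p, q, x, t, hT, hp, hq, hpq, h0, h1, hx⟩ := h
    have e1 := (split_hull hT hp hq hpq h0 h1 hx).1
    have e2 := (split_hull' hT hp hq hpq h0 h1 hx).1
    simp only [Multiset.forall_mem_cons]
    tauto
  | refl x => rfl
  | symm x y _ ih => exact ih.symm
  | trans x y z _ _ ih1 ih2 => exact ih1.trans ih2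

/-- open cone over `T` along the face `A` -/
def oc {n : ℕ} (A T : Finset (Euc n)) : Set (Euc n) := {x | ∀ v ∈ T, v ∉ A → 0 < co T v x}

lemma oc_open {n : ℕ} (A T : Finset (Euc n)) : IsOpen (oc A T) := by
  have : oc A T = ⋂ v ∈ T.filter (fun v => v ∉ A), {x | 0 < co T v x} := by
    ext x; simp [oc]
  rw [this]
  apply isOpen_biInter_finset
  intro v _
  exact isOpen_lt continuous_const (co_cont _)

lemma oc_empty {n : ℕ} {T : Finset (Euc n)} {x : Euc n} (h : x ∈ oc ∅ T) (v : Euc n) (hv : v ∈ T) :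
    0 < co T v x := h v hv (by simp)

lemma oc_mono {n : ℕ} {A T : Finset (Euc n)} {x : Euc n} (h : x ∈ oc ∅ T) : x ∈ oc A T :=
  fun v hv _ => oc_empty h v hv

lemma oc_hull {n : ℕ} {T : Finset (Euc n)} (hT : Smp T) {x : Euc n} (h : x ∈ oc ∅ T) :
    x ∈ hull T := (mem_hull hT).2 fun v hv => (oc_empty h v hv).le

lemma smp_nonempty {n : ℕ} {T : Finset (Euc n)} (hT : Smp T) : T.Nonempty := by
  rw [← Finset.card_pos, hT.2]; omega

lemma oc_nonempty {n : ℕ} {T : Finset (Euc n)} (hT : Smp T) : ∃ x, x ∈ oc ∅ T := by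
  have hc : (0:ℝ) < T.card := by exact_mod_cast Finset.card_pos.2 (smp_nonempty hT)
  refine ⟨∑ v ∈ T, (1 / T.card : ℝ) • v, fun v hv _ => ?_⟩
  rw [co_of_comb (w := fun _ => (1 / T.card : ℝ)) hT le_rfl (by simp; field_simp) hv, if_pos hv]
  positivity

lemma co_ne_zero {n : ℕ} {T : Finset (Euc n)} (hT : Smp T) {v : Euc n} (hv : v ∈ T) :
    co T v ≠ 0 := by
  intro h
  have := co_self hT hv
  rw [h] at this
  simp at this

lemma aff_pos {n : ℕ} {T : Finset (Euc n)} (hT : Smp T) {x : Euc n} (hx : x ∈ oc ∅ T)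
    {h : Euc n →ᵃ[ℝ] ℝ} (hh : ∀ v ∈ T, 0 ≤ h v) (hne : h ≠ 0) : 0 < h x := by
  rw [aff_eq hT h x]
  by_contra hcon
  apply hne
  apply aff_ext hT
  intro v hv
  have hnn : ∀ v ∈ T, 0 ≤ co T v x * h v := fun v hv =>
    mul_nonneg (oc_empty hx v hv).le (hh v hv)
  have := (Finset.sum_eq_zero_iff_of_nonneg hnn).1
    (le_antisymm (not_lt.1 hcon) (Finset.sum_nonneg hnn)) v hv
  rcases mul_eq_zero.1 this with h' | h'
  · exact absurd h' (oc_empty hx v hv).ne'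
  · simpa using h'

lemma aff_neg {n : ℕ} {T : Finset (Euc n)} (hT : Smp T) {x : Euc n} (hx : x ∈ oc ∅ T)
    {h : Euc n →ᵃ[ℝ] ℝ} (hh : ∀ v ∈ T, h v ≤ 0) (hne : h ≠ 0) : h x < 0 := by
  have := aff_pos hT hx (h := -h) (fun v hv => by simpa using hh v hv) (by simpa using hne)
  simpa using this

/-- generic points avoid all coordinate hyperplanes -/
lemma ae_co {n : ℕ} {T : Finset (Euc n)} (hT : Smp T) :
    ∀ᵐ x : Euc n, ∀ v ∈ T, co T v x ≠ 0 := by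
  rw [Finset.eventually_all]
  exact fun v hv => ae_ne (co_ne_zero hT hv)

lemma ae_exists {n : ℕ} {U : Set (Euc n)} (hU : IsOpen U) (hne : U.Nonempty) {p : Euc n → Prop}
    (hp : ∀ᵐ x : Euc n, p x) : ∃ x ∈ U, p x := by
  by_contra! h
  have h1 : volume U ≤ volume {x | ¬ p x} := measure_mono fun x hx => h x hx
  rw [ae_iff] at hp
  rw [hp] at h1
  exact (hU.measure_pos volume hne).ne' (le_antisymm h1 bot_le)

lemma hull_seg {n : ℕ} {T : Finset (Euc n)} (hT : Smp T) {x y : Euc n} (hx : x ∈ hull T)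
    (hy : y ∈ oc ∅ T) {t : ℝ} (h0 : 0 < t) (h1 : t ≤ 1) : (1 - t) • x + t • y ∈ oc ∅ T := by
  intro v hv _
  rw [co_seg (T := T) rfl]
  have := (mem_hull hT).1 hx v hv
  have := oc_empty hy v hv
  have : 0 ≤ 1 - t := by linarith
  positivity

/-- an open set meeting `hull T` meets its interior -/
lemma open_meets {n : ℕ} {T : Finset (Euc n)} (hT : Smp T) {U : Set (Euc n)} (hU : IsOpen U)
    {x : Euc n} (hx : x ∈ hull T) (hxU : x ∈ U) : ∃ y ∈ U, y ∈ oc ∅ T := by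
  obtain ⟨z, hz⟩ := oc_nonempty hT
  have hc : Continuous (fun t : ℝ => (1 - t) • x + t • z) := by fun_prop
  have h0 : (fun t : ℝ => (1 - t) • x + t • z) 0 ∈ U := by simpa using hxU
  have h1 := (hU.preimage hc).mem_nhds h0
  obtain ⟨ε, hε, hb⟩ := Metric.mem_nhds_iff.1 h1
  refine ⟨_, hb (a := min (ε / 2) 1) ?_, hull_seg hT hx hz (by positivity) (min_le_right _ _)⟩
  rw [Metric.mem_ball, Real.dist_0_eq_abs, abs_of_pos (by positivity)]
  exact lt_of_le_of_lt (min_le_left _ _) (by linarith)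

/-- `U` can be processed before `V` when sweeping away from `a` -/
def before {n : ℕ} (a : Euc n) (U V : Finset (Euc n)) : Prop :=
  ∃ g : Euc n →ᵃ[ℝ] ℝ, g ≠ 0 ∧ g a ≤ 0 ∧ (∀ u ∈ U, g u ≤ 0) ∧ ∀ v ∈ V, 0 ≤ g v

def adapted {n : ℕ} (h : Euc n →ᵃ[ℝ] ℝ) (U : Finset (Euc n)) : Prop :=
  (∀ u ∈ U, h u ≤ 0) ∨ ∀ u ∈ U, 0 ≤ h u

lemma mem_hull_self {n : ℕ} {U : Finset (Euc n)} {u : Euc n} (hu : u ∈ U) : u ∈ hull U :=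
  subset_convexHull ℝ _ hu

lemma nonneg_sub {n : ℕ} {U U' : Finset (Euc n)} (hU : Smp U) (hs : hull U' ⊆ hull U)
    {h : Euc n →ᵃ[ℝ] ℝ} (hh : ∀ u ∈ U, 0 ≤ h u) : ∀ u ∈ U', 0 ≤ h u :=
  fun _ hu => co_nonneg hU (hs (mem_hull_self hu)) hh

lemma nonpos_sub {n : ℕ} {U U' : Finset (Euc n)} (hU : Smp U) (hs : hull U' ⊆ hull U)
    {h : Euc n →ᵃ[ℝ] ℝ} (hh : ∀ u ∈ U, h u ≤ 0) : ∀ u ∈ U', h u ≤ 0 :=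
  fun _ hu => co_nonpos hU (hs (mem_hull_self hu)) hh

lemma adapted_sub {n : ℕ} {U U' : Finset (Euc n)} (hU : Smp U) (hs : hull U' ⊆ hull U)
    {h : Euc n →ᵃ[ℝ] ℝ} (hh : adapted h U) : adapted h U' :=
  hh.imp (nonpos_sub hU hs) (nonneg_sub hU hs)

lemma before_sub {n : ℕ} {a : Euc n} {U U' V V' : Finset (Euc n)} (hU : Smp U) (hV : Smp V)
    (hs : hull U' ⊆ hull U) (hs' : hull V' ⊆ hull V) (h : before a U V) : before a U' V' := by
  obtain ⟨g, h1, h2, h3, h4⟩ := h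
  exact ⟨g, h1, h2, nonpos_sub hU hs h3, nonneg_sub hV hs' h4⟩

lemma Eqv.flat {n : ℕ} (f : Finset (Euc n) → List (Finset (Euc n))) :
    ∀ (L : List (Finset (Euc n))) (_ : ∀ U ∈ L, Eqv {U} (f U : Multiset _)),
      Eqv (L : Multiset _) ((L.flatMap f : List _) : Multiset (Finset (Euc n)))
  | [], _ => Eqv.refl _
  | U :: L, h => by
    have h1 := h U (by simp)
    have h2 := Eqv.flat f L fun U hU => h U (by simp [hU])
    have := h1.add h2
    rw [List.flatMap_cons, ← Multiset.coe_add, ← Multiset.cons_coe, ← Multiset.singleton_add]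
    exact this

lemma cut1 {n : ℕ} (a : Euc n) (h : Euc n →ᵃ[ℝ] ℝ) (A : Finset (Euc n)) (hA : ∀ v ∈ A, h v = 0) :
    ∀ (k : ℕ) (T : Finset (Euc n)) (_ : Smp T) (_ : A ⊆ T)
      (_ : (T.filter (fun v => h v ≠ 0)).card ≤ k),
    ∃ L : List (Finset (Euc n)), Eqv {T} (L : Multiset _) ∧
      (∀ U ∈ L, Smp U ∧ hull U ⊆ hull T ∧ A ⊆ U ∧ adapted h U) ∧ L.Pairwise (before a) := by
  intro k
  induction k with
  | zero =>
    intro T hT hAT hk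
    refine ⟨[T], Eqv.refl _, ?_, by simp⟩
    intro U hU
    rw [List.mem_singleton] at hU
    subst hU
    refine ⟨hT, le_rfl, hAT, Or.inl fun u hu => ?_⟩
    simp only [Nat.le_zero, Finset.card_eq_zero, Finset.filter_eq_empty_iff, not_not] at hk
    exact (hk hu).le
  | succ k ih =>
    intro T hT hAT hk
    by_cases had : adapted h T
    · refine ⟨[T], Eqv.refl _, ?_, by simp⟩
      intro U hU
      rw [List.mem_singleton] at hU
      subst hU
      exact ⟨hT, le_rfl, hAT, had⟩
    simp only [adapted, not_or, not_forall, not_le] at had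
    obtain ⟨⟨q, hq, hq0⟩, ⟨p, hp, hp0⟩⟩ := had
    have hpq : p ≠ q := by rintro rfl; linarith
    set t := h p / (h p - h q) with ht
    have hd : h p - h q < 0 := by linarith
    have h0 : 0 < t := div_pos_of_neg_of_neg hp0 hd
    have h1 : t < 1 := by rw [ht, div_lt_one_of_neg hd]; linarith
    set x := (1 - t) • p + t • q with hx
    have hhx : h x = 0 := by
      rw [co_seg (T := T) hx, ht]; field_simp [hd.ne]; ring
    obtain ⟨s1, e1⟩ := split_hull hT hp hq hpq h0 h1 hx
    obtain ⟨s2, e2⟩ := split_hull' hT hp hq hpq h0 h1 hx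
    have red : ∀ r ∈ T, h r ≠ 0 → ((rep T r x).filter (fun v => h v ≠ 0)).card ≤ k ∧
        A ⊆ rep T r x := by
      intro r hr hr0
      constructor
      · have : (rep T r x).filter (fun v => h v ≠ 0) ⊆ (T.filter (fun v => h v ≠ 0)).erase r := by
          intro v hv
          rw [Finset.mem_filter, rep, Finset.mem_insert, Finset.mem_erase] at hv
          rw [Finset.mem_erase, Finset.mem_filter]
          rcases hv with ⟨rfl | ⟨h3, h4⟩, h5⟩
          · exact absurd hhx h5
          · exact ⟨h3, h4, h5⟩
        have h3 := Finset.card_le_card this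
        rw [Finset.card_erase_of_mem (Finset.mem_filter.2 ⟨hr, hr0⟩)] at h3
        omega
      · intro v hv
        refine Finset.mem_insert_of_mem (Finset.mem_erase.2 ⟨?_, hAT hv⟩)
        rintro rfl
        exact hr0 (hA _ hv)
    obtain ⟨L1, E1, P1, W1⟩ := ih _ s1 (red q hq hq0.ne').2 (red q hq hq0.ne').1
    obtain ⟨L2, E2, P2, W2⟩ := ih _ s2 (red p hp hp0.ne).2 (red p hp hp0.ne).1
    have E := Eqv.step hT hp hq hpq h0 h1 hx
    have i1 : hull (rep T q x) ⊆ hull T := by rw [e1]; exact inter_subset_left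
    have i2 : hull (rep T p x) ⊆ hull T := by rw [e2]; exact inter_subset_left
    have hmem : ∀ U ∈ L1 ++ L2, Smp U ∧ hull U ⊆ hull T ∧ A ⊆ U ∧ adapted h U := by
      intro U hU
      rcases List.mem_append.1 hU with hU | hU
      · obtain ⟨a1, a2, a3⟩ := P1 U hU
        exact ⟨a1, a2.trans i1, a3⟩
      · obtain ⟨a1, a2, a3⟩ := P2 U hU
        exact ⟨a1, a2.trans i2, a3⟩
    have sg1 : ∀ U ∈ L1, ∀ u ∈ U, sepf T p q t u ≤ 0 := by
      intro U hU u hu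
      have := (P1 U hU).2.1 (mem_hull_self hu)
      rw [e1] at this
      exact this.2
    have sg2 : ∀ U ∈ L2, ∀ u ∈ U, 0 ≤ sepf T p q t u := by
      intro U hU u hu
      have := (P2 U hU).2.1 (mem_hull_self hu)
      rw [e2] at this
      exact this.2
    have hne := sepf_ne hT hp hq hpq h0
    rcases le_total (sepf T p q t a) 0 with ha | ha
    · refine ⟨L1 ++ L2, ?_, hmem, ?_⟩
      · refine E.trans ?_
        rw [← Multiset.coe_add, add_comm]
        exact E1.add E2
      · rw [List.pairwise_append]
        exact ⟨W1, W2, fun U hU V hV => ⟨_, hne, ha, sg1 U hU, sg2 V hV⟩⟩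
    · refine ⟨L2 ++ L1, ?_, fun U hU => hmem U ?_, ?_⟩
      · refine E.trans ?_
        rw [← Multiset.coe_add]
        exact E2.add E1
      · simp only [List.mem_append] at hU ⊢; tauto
      · rw [List.pairwise_append]
        exact ⟨W2, W1, fun U hU V hV => ⟨- sepf T p q t, by simpa using hne, by simpa using ha,
          fun u hu => by simpa using sg2 U hU u hu, fun u hu => by simpa using sg1 V hV u hu⟩⟩

lemma cutL {n : ℕ} (a : Euc n) (A : Finset (Euc n)) (hs : List (Euc n →ᵃ[ℝ] ℝ))
    (hA : ∀ h ∈ hs, ∀ v ∈ A, h v = 0) :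
    ∀ (T : Finset (Euc n)) (_ : Smp T) (_ : A ⊆ T),
    ∃ L : List (Finset (Euc n)), Eqv {T} (L : Multiset _) ∧
      (∀ U ∈ L, Smp U ∧ hull U ⊆ hull T ∧ A ⊆ U ∧ ∀ h ∈ hs, adapted h U) ∧
      L.Pairwise (before a) := by
  induction hs with
  | nil =>
    intro T hT hAT
    refine ⟨[T], Eqv.refl _, ?_, by simp⟩
    intro U hU
    rw [List.mem_singleton] at hU
    subst hU
    exact ⟨hT, le_rfl, hAT, by simp⟩
  | cons h hs ih =>
    intro T hT hAT
    have ih := ih fun h' hh' => hA h' (by simp [hh'])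
    obtain ⟨L, E, P, W⟩ := cut1 a h A (hA h (by simp)) _ T hT hAT le_rfl
    have : ∀ U : Finset (Euc n), ∃ L' : List (Finset (Euc n)), U ∈ L → (Eqv {U} (L' : Multiset _) ∧
      (∀ V ∈ L', Smp V ∧ hull V ⊆ hull U ∧ A ⊆ V ∧ ∀ h ∈ hs, adapted h V) ∧
      L'.Pairwise (before a)) := by
      intro U
      by_cases hU : U ∈ L
      · obtain ⟨L', h'⟩ := ih U (P U hU).1 (P U hU).2.2.1
        exact ⟨L', fun _ => h'⟩
      · exact ⟨[], fun h => absurd h hU⟩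
    choose f hf using this
    refine ⟨L.flatMap f, E.trans (Eqv.flat f L fun U hU => (hf U hU).1), ?_, ?_⟩
    · intro V hV
      obtain ⟨U, hU, hVU⟩ := List.mem_flatMap.1 hV
      obtain ⟨b1, b2, b3, b4⟩ := (hf U hU).2.1 V hVU
      obtain ⟨c1, c2, c3, c4⟩ := P U hU
      refine ⟨b1, b2.trans c2, b3, ?_⟩
      intro h' hh'
      rcases List.mem_cons.1 hh' with rfl | hh'
      · exact adapted_sub c1 b2 c4
      · exact b4 h' hh'
    · rw [List.pairwise_flatMap]
      refine ⟨fun U hU => (hf U hU).2.2, ?_⟩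
      refine List.Pairwise.imp_of_mem ?_ W
      intro U V hU hV hb U' hU' V' hV'
      exact before_sub (P U hU).1 (P V hV).1 ((hf U hU).2.1 _ hU').2.1 ((hf V hV).2.1 _ hV').2.1 hb

def sepBy {n : ℕ} (hs : List (Euc n →ᵃ[ℝ] ℝ)) (U V : Finset (Euc n)) : Prop :=
  ∃ h ∈ hs, ((∀ u ∈ U, 0 ≤ h u) ∧ ∀ v ∈ V, h v ≤ 0) ∨ ((∀ u ∈ U, h u ≤ 0) ∧ ∀ v ∈ V, 0 ≤ h v)

lemma aff_zero {n : ℕ} {T : Finset (Euc n)} (hT : Smp T) {h : Euc n →ᵃ[ℝ] ℝ}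
    (h1 : ∀ v ∈ T, 0 ≤ h v) (h2 : ∀ v ∈ T, h v ≤ 0) : h = 0 :=
  aff_ext hT fun v hv => by simpa using le_antisymm (h2 v hv) (h1 v hv)

lemma sortL {n : ℕ} (a : Euc n) (hs : List (Euc n →ᵃ[ℝ] ℝ)) (hne : ∀ h ∈ hs, h ≠ 0) :
    ∀ (L : List (Finset (Euc n))) (_ : ∀ U ∈ L, Smp U ∧ ∀ h ∈ hs, adapted h U)
      (_ : L.Pairwise (fun U V => before a U V ∨ sepBy hs U V)),
    ∃ L' : List (Finset (Euc n)), L'.Perm L ∧ L'.Pairwise (before a) := by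
  induction hs with
  | nil =>
    intro L _ hL
    refine ⟨L, List.Perm.refl _, hL.imp ?_⟩
    rintro U V (h | ⟨h, hh, _⟩)
    · exact h
    · simp at hh
  | cons h hs ih =>
    intro L hL hW
    have ih := ih fun h' hh' => hne h' (by simp [hh'])
    have hh0 := hne h (by simp)
    obtain ⟨g, hg, hga⟩ : ∃ g : Euc n →ᵃ[ℝ] ℝ, (g = h ∨ g = -h) ∧ g a ≤ 0 := by
      rcases le_total (h a) 0 with h' | h'
      · exact ⟨h, Or.inl rfl, h'⟩
      · exact ⟨-h, Or.inr rfl, by simpa using h'⟩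
    have hg0 : g ≠ 0 := by rcases hg with rfl | rfl <;> simpa using hh0
    have hgad : ∀ U ∈ L, adapted g U := by
      intro U hU
      have := (hL U hU).2 h (by simp)
      rcases hg with rfl | rfl
      · exact this
      · rcases this with h' | h'
        · exact Or.inr fun u hu => by simpa using h' u hu
        · exact Or.inl fun u hu => by simpa using h' u hu
    have hsep : ∀ U V, sepBy (h :: hs) U V → sepBy hs U V ∨
        ((∀ u ∈ U, 0 ≤ g u) ∧ ∀ v ∈ V, g v ≤ 0) ∨ ((∀ u ∈ U, g u ≤ 0) ∧ ∀ v ∈ V, 0 ≤ g v) := by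
      rintro U V ⟨h', hh', hc⟩
      rcases List.mem_cons.1 hh' with rfl | hh'
      · right
        rcases hg with rfl | rfl
        · exact hc
        · simpa using hc.symm
      · exact Or.inl ⟨h', hh', hc⟩
    set P : Finset (Euc n) → Prop := fun U => ∀ u ∈ U, g u ≤ 0 with hP
    have hP' : ∀ U ∈ L, ¬ P U → ∀ u ∈ U, 0 ≤ g u := fun U hU hn =>
      (hgad U hU).resolve_left hn
    obtain ⟨L1, p1, w1⟩ := ih (L.filter (fun U => P U))
      (fun U hU => by
        have := hL U (List.mem_filter.1 hU).1
        exact ⟨this.1, fun h' hh' => this.2 h' (by simp [hh'])⟩) (by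
        refine List.Pairwise.imp_of_mem ?_ (hW.filter _)
        intro U V hU hV hUV
        rw [List.mem_filter, decide_eq_true_iff] at hU hV
        refine hUV.imp_right fun hUV => ?_
        rcases hsep U V hUV with h' | h' | h'
        · exact h'
        · exact absurd (aff_zero (hL U hU.1).1 h'.1 hU.2) hg0
        · exact absurd (aff_zero (hL V hV.1).1 h'.2 hV.2) hg0)
    obtain ⟨L2, p2, w2⟩ := ih (L.filter (fun U => ! decide (P U)))
      (fun U hU => by
        have := hL U (List.mem_filter.1 hU).1
        exact ⟨this.1, fun h' hh' => this.2 h' (by simp [hh'])⟩) (by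
        refine List.Pairwise.imp_of_mem ?_ (hW.filter _)
        intro U V hU hV hUV
        rw [List.mem_filter, Bool.not_eq_true', decide_eq_false_iff_not] at hU hV
        refine hUV.imp_right fun hUV => ?_
        rcases hsep U V hUV with h' | h' | h'
        · exact h'
        · exact absurd h'.2 hV.2
        · exact absurd h'.1 hU.2)
    refine ⟨L1 ++ L2, (p1.append p2).trans (List.filter_append_perm _ L), ?_⟩
    rw [List.pairwise_append]
    refine ⟨w1, w2, fun U hU V hV => ⟨g, hg0, hga, ?_, ?_⟩⟩
    · have := p1.subset hU
      rw [List.mem_filter, decide_eq_true_iff] at this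
      exact this.2
    · have := p2.subset hV
      rw [List.mem_filter, Bool.not_eq_true', decide_eq_false_iff_not] at this
      exact hP' V this.1 this.2

lemma cutF {n : ℕ} (a : Euc n) (A : Finset (Euc n)) (hs : List (Euc n →ᵃ[ℝ] ℝ))
    (hA : ∀ h ∈ hs, ∀ v ∈ A, h v = 0) (L : List (Finset (Euc n)))
    (hL : ∀ T ∈ L, Smp T ∧ A ⊆ T) :
    ∃ f : Finset (Euc n) → List (Finset (Euc n)), ∀ T ∈ L, Eqv {T} (f T : Multiset _) ∧
      (∀ U ∈ f T, Smp U ∧ hull U ⊆ hull T ∧ A ⊆ U ∧ ∀ h ∈ hs, adapted h U) ∧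
      (f T).Pairwise (before a) := by
  have : ∀ U : Finset (Euc n), ∃ L' : List (Finset (Euc n)), U ∈ L → (Eqv {U} (L' : Multiset _) ∧
      (∀ V ∈ L', Smp V ∧ hull V ⊆ hull U ∧ A ⊆ V ∧ ∀ h ∈ hs, adapted h V) ∧
      L'.Pairwise (before a)) := by
    intro U
    by_cases hU : U ∈ L
    · obtain ⟨L', h'⟩ := cutL a A hs hA U (hL U hU).1 (hL U hU).2
      exact ⟨L', fun _ => h'⟩
    · exact ⟨[], fun h => absurd h hU⟩
  choose f hf using this
  exact ⟨f, hf⟩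

def cen {n : ℕ} (A : Finset (Euc n)) : Euc n := ∑ v ∈ A, (1 / A.card : ℝ) • v

lemma co_cen {n : ℕ} {A T : Finset (Euc n)} (hT : Smp T) (hA : A ⊆ T) (hne : A.Nonempty)
    {v : Euc n} (hv : v ∈ T) : co T v (cen A) = if v ∈ A then (1 / A.card : ℝ) else 0 := by
  have hc : (0:ℝ) < A.card := by exact_mod_cast Finset.card_pos.2 hne
  exact co_of_comb (w := fun _ => (1 / A.card : ℝ)) hT hA (by simp; field_simp) hv

lemma shrink {n : ℕ} {A T : Finset (Euc n)} (hT : Smp T) (hA : A ⊆ T) (hne : A.Nonempty)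
    {y : Euc n} (hy : y ∈ oc A T) :
    ∀ᶠ s in nhdsWithin (0:ℝ) (Ioi 0), (1 - s) • cen A + s • y ∈ oc ∅ T := by
  have hc : (0:ℝ) < A.card := by exact_mod_cast Finset.card_pos.2 hne
  have : ∀ᶠ s in nhdsWithin (0:ℝ) (Ioi 0), ∀ v ∈ T, 0 < co T v ((1 - s) • cen A + s • y) := by
    rw [Finset.eventually_all]
    intro v hv
    by_cases hvA : v ∈ A
    · apply Filter.Eventually.filter_mono nhdsWithin_le_nhds
      have hcont : Continuous fun s : ℝ => co T v ((1 - s) • cen A + s • y) :=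
        (co_cont _).comp (by fun_prop)
      apply hcont.continuousAt.eventually_const_lt
      simp only [sub_zero, one_smul, zero_smul, add_zero]
      rw [co_cen hT hA hne hv, if_pos hvA]
      positivity
    · filter_upwards [self_mem_nhdsWithin] with s hs
      have hs : 0 < s := hs
      rw [co_seg (T := T) rfl, co_cen hT hA hne hv, if_neg hvA]
      have := hy v hv hvA
      simp only [mul_zero, zero_add]
      positivity
  filter_upwards [this] with s hs v hv _ using hs v hv

lemma lemX {n : ℕ} {A T T' : Finset (Euc n)} (hT : Smp T) (hT' : Smp T') (hA : A ⊆ T) (hA' : A ⊆ T')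
    (hd : ∀ᵐ x : Euc n, ¬ (x ∈ hull T ∧ x ∈ hull T')) {y : Euc n} (hy : y ∈ oc A T)
    (hy' : y ∈ oc A T') : False := by
  have main : ∀ z, z ∈ oc ∅ T → z ∈ oc ∅ T' → False := by
    intro z hz hz'
    obtain ⟨x, hx, hx2⟩ := ae_exists ((oc_open ∅ T).inter (oc_open ∅ T')) ⟨z, hz, hz'⟩ hd
    exact hx2 ⟨oc_hull hT hx.1, oc_hull hT' hx.2⟩
  rcases A.eq_empty_or_nonempty with rfl | hne
  · exact main y hy hy'
  · obtain ⟨s, h1, h2⟩ := ((shrink hT hA hne hy).and (shrink hT' hA' hne hy')).exists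
    exact main _ h1 h2

lemma cnt_two {n : ℕ} {M : Multiset (Finset (Euc n))} (h : ∀ᵐ x : Euc n, cnt M x ≤ 1)
    {T T' : Finset (Euc n)} (hT : T ∈ M) (hT' : T' ∈ M) (hne : T ≠ T') :
    ∀ᵐ x : Euc n, ¬ (x ∈ hull T ∧ x ∈ hull T') := by
  obtain ⟨M1, rfl⟩ := Multiset.exists_cons_of_mem hT
  have hT1 : T' ∈ M1 := by
    rcases Multiset.mem_cons.1 hT' with h | h
    · exact absurd h.symm hne
    · exact h
  obtain ⟨M2, rfl⟩ := Multiset.exists_cons_of_mem hT1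
  filter_upwards [h] with x hx
  rintro ⟨h1, h2⟩
  rw [cnt_cons, cnt_cons, if_pos h1, if_pos h2] at hx
  omega

lemma cnt_pairwise {n : ℕ} : ∀ (L : List (Finset (Euc n)))
    (_ : ∀ᵐ x : Euc n, cnt (L : Multiset _) x ≤ 1),
    L.Pairwise (fun T T' => ∀ᵐ x : Euc n, ¬ (x ∈ hull T ∧ x ∈ hull T'))
  | [], _ => List.Pairwise.nil
  | T :: L, h => by
    rw [List.pairwise_cons]
    constructor
    · intro T' hT'
      filter_upwards [h] with x hx
      rintro ⟨h1, h2⟩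
      rw [← Multiset.cons_coe, cnt_cons, if_pos h1] at hx
      have : 0 < cnt (L : Multiset _) x := cnt_pos.2 ⟨T', by simpa using hT', h2⟩
      omega
    · apply cnt_pairwise L
      filter_upwards [h] with x hx
      rw [← Multiset.cons_coe, cnt_cons] at hx
      omega

lemma hull_closed {n : ℕ} (T : Finset (Euc n)) : IsClosed (hull T) :=
  T.finite_toSet.isClosed_convexHull (𝕜 := ℝ)

lemma lem_sub {n : ℕ} {S : Finset (Euc n)} {M : Multiset (Finset (Euc n))} (hS : Smp S)
    (hM : ∀ T ∈ M, Smp T) (hc : ∀ᵐ x : Euc n, cnt M x = cnt {S} x) :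
    ∀ T ∈ M, hull T ⊆ hull S := by
  intro T hT
  refine convexHull_min ?_ (convex_convexHull ℝ _)
  intro p hp
  rw [mem_hull hS]
  by_contra! hcon
  obtain ⟨v, hv, hneg⟩ := hcon
  have hO : IsOpen {y : Euc n | co S v y < 0} := isOpen_lt (co_cont _) continuous_const
  obtain ⟨y, hy, hy'⟩ := open_meets (hM T hT) hO (mem_hull_self hp) hneg
  obtain ⟨x, hx, hx2⟩ := ae_exists (hO.inter (oc_open ∅ T)) ⟨y, hy, hy'⟩ hc
  have h1 : 0 < cnt M x := cnt_pos.2 ⟨T, hT, oc_hull (hM T hT) hx.2⟩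
  rw [hx2, cnt_single, if_neg] at h1
  · exact lt_irrefl _ h1
  · intro h
    have h3 := (mem_hull hS).1 h v hv
    exact absurd hx.1 (not_lt.2 h3)

lemma lem_cover {n : ℕ} {S : Finset (Euc n)} {M : Multiset (Finset (Euc n))} (hS : Smp S)
    (hc : ∀ᵐ x : Euc n, cnt M x = cnt {S} x) {x : Euc n} (hx : x ∈ hull S) :
    ∃ T ∈ M, x ∈ hull T := by
  by_contra! hcon
  have hcl : IsClosed (⋃ T ∈ M.toFinset, hull T) :=
    isClosed_biUnion_finset fun T _ => hull_closed T
  obtain ⟨y, hy, hy'⟩ := open_meets hS hcl.isOpen_compl hx (by simpa using hcon)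
  obtain ⟨z, hz, hz2⟩ := ae_exists (hcl.isOpen_compl.inter (oc_open ∅ S)) ⟨y, hy, hy'⟩ hc
  rw [cnt_single, if_pos (oc_hull hS hz.2)] at hz2
  have : 0 < cnt M z := by omega
  obtain ⟨T, hT, hzT⟩ := cnt_pos.1 this
  apply hz.1
  simp only [mem_iUnion]
  exact ⟨T, by simpa using hT, hzT⟩

lemma lemL {n : ℕ} {A S : Finset (Euc n)} {M : Multiset (Finset (Euc n))} (hS : Smp S) (hA : A ⊆ S)
    (hM : ∀ T ∈ M, Smp T ∧ A ⊆ T) (hc : ∀ᵐ x : Euc n, cnt M x = cnt {S} x)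
    {T : Finset (Euc n)} (hTM : T ∈ M) {v : Euc n} (hv : v ∈ A) : co T v = co S v := by
  obtain ⟨hT, hAT⟩ := hM T hTM
  have hsub := lem_sub hS (fun T hT => (hM T hT).1) hc T hTM
  by_cases hAS : A = S
  · have : S = T := Finset.eq_of_subset_of_card_le (hAS ▸ hAT) (by rw [hT.2, hS.2])
    rw [this]
  obtain ⟨y, hy, hyS⟩ := ae_exists (oc_open ∅ T) (oc_nonempty hT) (ae_co hS)
  have hyS' := (mem_hull hS).1 (hsub (oc_hull hT hy))
  have hpos : ∀ u ∈ S, 0 < co S u y := fun u hu => lt_of_le_of_ne (hyS' u hu) (hyS u hu).symm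
  have hne : (S \ A).Nonempty := by
    rw [Finset.sdiff_nonempty]
    exact fun h => hAS (Finset.Subset.antisymm hA h)
  set σ := ∑ u ∈ S \ A, co S u y with hσ
  have hσ0 : 0 < σ := Finset.sum_pos (fun u hu => hpos u (Finset.mem_sdiff.1 hu).1) hne
  set w : Euc n → ℝ := fun u => co S u y / σ with hw
  have hw1 : ∑ u ∈ S \ A, w u = 1 := by rw [hw, ← Finset.sum_div, div_self hσ0.ne']
  set y' := ∑ u ∈ S \ A, w u • u with hy'
  have hcoS : ∀ u ∈ S, co S u y' = if u ∈ S \ A then w u else 0 := fun u hu =>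
    co_of_comb hS Finset.sdiff_subset hw1 hu
  have hy'S : y' ∈ hull S := by
    rw [mem_hull hS]
    intro u hu
    rw [hcoS u hu]
    split_ifs
    · exact div_nonneg (hpos u hu).le hσ0.le
    · exact le_rfl
  have hy'T : y' ∈ oc A T := by
    intro p hp hpA
    have h1 : co T p y' = co T p y / σ := by
      rw [hy', aff_comb _ _ _ hw1, aff_eq hS (co T p) y, ← Finset.sum_sdiff hA]
      have : ∑ u ∈ A, co S u y * co T p u = 0 := Finset.sum_eq_zero fun u hu => by
        rw [co_ne hT hp (hAT hu), mul_zero]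
        rintro rfl; exact hpA hu
      rw [this, add_zero, Finset.sum_div]
      refine Finset.sum_congr rfl fun u _ => ?_
      rw [hw]; ring
    rw [h1]
    exact div_pos (oc_empty hy p hp) hσ0
  have hle : ∀ᵐ x : Euc n, cnt M x ≤ 1 := by
    filter_upwards [hc] with x hx
    rw [hx, cnt_single]; split_ifs <;> simp
  obtain ⟨T', hT'M, hyT'⟩ := lem_cover hS hc hy'S
  have hTT : T = T' := by
    by_contra hTT
    obtain ⟨z, hz, hz'⟩ := open_meets (hM T' hT'M).1 (oc_open A T) hyT' hy'T
    exact lemX hT (hM T' hT'M).1 hAT (hM T' hT'M).2 (cnt_two hle hTM hT'M hTT) hz (oc_mono hz')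
  rw [← hTT] at hyT'
  have hzero : co S v y' = 0 := by
    rw [hcoS v (hA hv), if_neg (by simp [hv])]
  rw [aff_eq hT (co S v) y'] at hzero
  have hnn : ∀ p ∈ T, 0 ≤ co S v p := fun p hp =>
    (mem_hull hS).1 (hsub (mem_hull_self hp)) v (hA hv)
  have hall := (Finset.sum_eq_zero_iff_of_nonneg (fun p hp =>
    mul_nonneg ((mem_hull hT).1 hyT' p hp) (hnn p hp))).1 hzero
  apply aff_ext hT
  intro p hp
  by_cases hpA : p ∈ A
  · by_cases hpv : p = v
    · rw [hpv, co_self hT (hAT hv), co_self hS (hA hv)]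
    · rw [co_ne hT (hAT hv) hp hpv, co_ne hS (hA hv) (hA hpA) hpv]
  · rw [co_ne hT (hAT hv) hp (by rintro rfl; exact hpA hv)]
    rcases mul_eq_zero.1 (hall p hp) with h | h
    · exact absurd h (hy'T p hp hpA).ne'
    · exact h.symm

def ClaimA {n : ℕ} (A : Finset (Euc n)) : Prop :=
  ∀ (S : Finset (Euc n)) (M : Multiset (Finset (Euc n))), Smp S → A ⊆ S →
    (∀ T ∈ M, Smp T ∧ A ⊆ T) → (∀ᵐ x : Euc n, cnt M x = cnt {S} x) → Eqv M {S}

lemma extract {n : ℕ} {A R : Finset (Euc n)} {M : Multiset (Finset (Euc n))} (hcl : ClaimA A)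
    (hM : ∀ T ∈ M, Smp T ∧ A ⊆ T) (hR : Smp R) (hA : A ⊆ R)
    (hc : ∀ᵐ x : Euc n, x ∈ oc A R → cnt M x = cnt {R} x) :
    ∃ M2 : Multiset (Finset (Euc n)), (∀ T ∈ M2, Smp T ∧ A ⊆ T) ∧ Eqv M (M2 + {R}) := by
  obtain ⟨L, rfl⟩ := Quot.exists_rep M
  have hL : ∀ T ∈ L, Smp T ∧ A ⊆ T := fun T hT => hM T hT
  change ∀ᵐ x : Euc n, x ∈ oc A R → cnt (L : Multiset _) x = cnt {R} x at hc
  change ∃ M2 : Multiset (Finset (Euc n)), (∀ T ∈ M2, Smp T ∧ A ⊆ T) ∧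
    Eqv (L : Multiset _) (M2 + {R})
  set hs := ((R \ A).toList).map (co R) with hhs
  have hmem : ∀ u ∈ R, u ∉ A → co R u ∈ hs := fun u hu huA =>
    List.mem_map.2 ⟨u, by simp [hu, huA], rfl⟩
  obtain ⟨f, hf⟩ := cutF 0 A hs (by
    intro h hh v hv
    obtain ⟨u, hu, rfl⟩ := List.mem_map.1 hh
    simp only [Finset.mem_toList, Finset.mem_sdiff] at hu
    exact co_ne hR hu.1 (hA hv) (by rintro rfl; exact hu.2 hv)) L hL
  have E := Eqv.flat f L fun U hU => (hf U hU).1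
  set M' : Multiset (Finset (Euc n)) := ((L.flatMap f : List _) : Multiset (Finset (Euc n))) with hM'
  have hmem' : ∀ U ∈ M', Smp U ∧ A ⊆ U ∧ ∀ h ∈ hs, adapted h U := by
    intro U hU
    obtain ⟨T, hT, hUT⟩ := List.mem_flatMap.1 (Multiset.mem_coe.1 hU)
    obtain ⟨a1, a2, a3, a4⟩ := (hf T hT).2.1 U hUT
    exact ⟨a1, a3, a4⟩
  set P : Finset (Euc n) → Prop := fun U => ∀ u ∈ R, u ∉ A → ∀ w ∈ U, 0 ≤ co R u w with hP
  have hsplit := Multiset.filter_add_not P M'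
  have hN : ∀ᵐ x : Euc n, cnt (M'.filter P) x = cnt {R} x := by
    filter_upwards [cnt_eqv E, hc, ae_co hR] with x h1 h2 h3
    by_cases hx : x ∈ oc A R
    · rw [← h2 hx, h1]
      conv_rhs => rw [← hsplit, cnt_add]
      have : cnt (M'.filter (fun U => ¬ P U)) x = 0 := by
        by_contra hcon
        obtain ⟨U, hU, hxU⟩ := cnt_pos.1 (Nat.pos_of_ne_zero hcon)
        rw [Multiset.mem_filter] at hU
        obtain ⟨hU, hUP⟩ := hU
        apply hUP
        intro u hu huA
        rcases (hmem' U hU).2.2 _ (hmem u hu huA) with h | h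
        · have := co_nonpos (hmem' U hU).1 hxU h
          have := hx u hu huA
          linarith
        · exact h
      omega
    · have hx' : ∃ u ∈ R, u ∉ A ∧ co R u x < 0 := by
        simp only [oc, Set.mem_setOf_eq, not_forall] at hx
        obtain ⟨u, hu, huA, hneg⟩ := hx
        exact ⟨u, hu, huA, lt_of_le_of_ne (not_lt.1 hneg) (h3 u hu)⟩
      obtain ⟨u, hu, huA, hneg⟩ := hx'
      rw [cnt_single, if_neg]
      · by_contra hcon
        obtain ⟨U, hU, hxU⟩ := cnt_pos.1 (Nat.pos_of_ne_zero hcon)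
        rw [Multiset.mem_filter] at hU
        have := co_nonneg (hmem' U hU.1).1 hxU (hU.2 u hu huA)
        linarith
      · intro h
        have := (mem_hull hR).1 h u hu
        linarith
  have EN := hcl R (M'.filter P) hR hA (fun T hT => by
    have := hmem' T (Multiset.mem_of_mem_filter hT)
    exact ⟨this.1, this.2.1⟩) hN
  refine ⟨M'.filter (fun U => ¬ P U), fun T hT => ?_, ?_⟩
  · have := hmem' T (Multiset.mem_of_mem_filter hT)
    exact ⟨this.1, this.2.1⟩
  · refine E.trans ?_
    exact (Eqv.of_eq (hsplit.symm.trans (add_comm _ _))).trans (EN.add_left _)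

lemma sorted_exists {n : ℕ} {A : Finset (Euc n)} (a : Euc n) {M : Multiset (Finset (Euc n))}
    (hM : ∀ T ∈ M, Smp T ∧ A ⊆ T) (hc : ∀ᵐ x : Euc n, cnt M x ≤ 1) :
    ∃ L : List (Finset (Euc n)), Eqv M (L : Multiset _) ∧ (∀ T ∈ L, Smp T ∧ A ⊆ T) ∧
      L.Pairwise (before a) := by
  obtain ⟨L, rfl⟩ := Quot.exists_rep M
  have hL : ∀ T ∈ L, Smp T ∧ A ⊆ T := fun T hT => hM T hT
  change ∀ᵐ x : Euc n, cnt (L : Multiset _) x ≤ 1 at hc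
  set hs : List (Euc n →ᵃ[ℝ] ℝ) := L.flatMap (fun T => ((T \ A).toList).map (co T)) with hhs
  have hmem : ∀ h, h ∈ hs ↔ ∃ T ∈ L, ∃ v ∈ T, v ∉ A ∧ co T v = h := by
    intro h
    simp only [hhs, List.mem_flatMap, List.mem_map, Finset.mem_toList, Finset.mem_sdiff, and_assoc]
  have hs0 : ∀ h ∈ hs, h ≠ 0 := by
    intro h hh
    obtain ⟨T, hT, v, hv, hvA, rfl⟩ := (hmem h).1 hh
    exact co_ne_zero (hL T hT).1 hv
  obtain ⟨f, hf⟩ := cutF a A hs (by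
    intro h hh u hu
    obtain ⟨T, hT, v, hv, hvA, rfl⟩ := (hmem h).1 hh
    exact co_ne (hL T hT).1 hv ((hL T hT).2 hu) (by rintro rfl; exact hvA hu)) L hL
  have E := Eqv.flat f L fun U hU => (hf U hU).1
  have hall : ∀ U ∈ L.flatMap f, Smp U ∧ A ⊆ U ∧ ∀ h ∈ hs, adapted h U := by
    intro U hU
    obtain ⟨T, hT, hUT⟩ := List.mem_flatMap.1 hU
    obtain ⟨a1, a2, a3, a4⟩ := (hf T hT).2.1 U hUT
    exact ⟨a1, a3, a4⟩
  obtain ⟨L', hp, hw⟩ := sortL a hs hs0 (L.flatMap f) (fun U hU => ⟨(hall U hU).1, (hall U hU).2.2⟩) (by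
    rw [List.pairwise_flatMap]
    refine ⟨fun U hU => (hf U hU).2.2.imp fun h => Or.inl h, ?_⟩
    refine List.Pairwise.imp_of_mem ?_ (cnt_pairwise L hc)
    intro T T' hT hT' hd U hU V hV
    right
    obtain ⟨u1, u2, u3, u4⟩ := (hf T hT).2.1 U hU
    obtain ⟨v1, v2, v3, v4⟩ := (hf T' hT').2.1 V hV
    by_contra hcon
    have key : ∀ p ∈ T, p ∉ A → ∀ w ∈ V, 0 ≤ co T p w := by
      intro p hp hpA
      have hin := (hmem (co T p)).2 ⟨T, hT, p, hp, hpA, rfl⟩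
      rcases v4 _ hin with h | h
      · exfalso
        apply hcon
        refine ⟨_, hin, Or.inl ⟨fun u hu => ?_, h⟩⟩
        exact (mem_hull (hL T hT).1).1 (u2 (mem_hull_self hu)) p hp
      · exact h
    obtain ⟨y, hy⟩ := oc_nonempty v1
    have hyT : y ∈ oc A T := fun p hp hpA =>
      aff_pos v1 hy (key p hp hpA) (co_ne_zero (hL T hT).1 hp)
    obtain ⟨z, hz, hz'⟩ := open_meets (hL T' hT').1 (oc_open A T) (v2 (oc_hull v1 hy)) hyT
    exact lemX (hL T hT).1 (hL T' hT').1 (hL T hT).2 (hL T' hT').2 hd hz (oc_mono hz'))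
  refine ⟨L', E.trans (Eqv.of_eq (Multiset.coe_eq_coe.2 hp.symm)), fun T hT => ?_, hw⟩
  have := hall T (hp.subset hT)
  exact ⟨this.1, this.2.1⟩

lemma extract_many {n : ℕ} {A : Finset (Euc n)} (hcl : ClaimA A) (R : Euc n → Finset (Euc n))
    (s : Finset (Euc n)) : ∀ (M : Multiset (Finset (Euc n))) (_ : ∀ T ∈ M, Smp T ∧ A ⊆ T)
    (_ : ∀ v ∈ s, Smp (R v) ∧ A ⊆ R v)
    (_ : ∀ v ∈ s, ∀ᵐ x : Euc n, x ∈ oc A (R v) → cnt M x = cnt {R v} x)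
    (_ : ∀ v ∈ s, ∀ v' ∈ s, v ≠ v' → ∀ᵐ x : Euc n, x ∈ oc A (R v') → x ∉ hull (R v)),
    ∃ M2 : Multiset (Finset (Euc n)), (∀ T ∈ M2, Smp T ∧ A ⊆ T) ∧
      Eqv M (M2 + ∑ v ∈ s, {R v}) := by
  induction s using Finset.induction_on with
  | empty =>
    intro M hM _ _ _
    exact ⟨M, hM, by simpa using Eqv.refl M⟩
  | insert v s hv ih =>
    intro M hM hR hc hd
    obtain ⟨M1, hM1, E1⟩ := extract hcl hM (hR v (by simp)).1 (hR v (by simp)).2 (hc v (by simp))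
    obtain ⟨M2, hM2, E2⟩ := ih M1 hM1 (fun u hu => hR u (by simp [hu])) (by
      intro u hu
      have huv : v ≠ u := by rintro rfl; exact hv hu
      filter_upwards [cnt_eqv E1, hc u (by simp [hu]), hd v (by simp) u (by simp [hu]) huv]
        with x h1 h2 h3 hx
      rw [cnt_add, cnt_single, if_neg (h3 hx), add_zero] at h1
      rw [← h1, h2 hx]) (by
      intro u hu u' hu' hne
      exact hd u (by simp [hu]) u' (by simp [hu']) hne)
    refine ⟨M2, hM2, ?_⟩
    rw [Finset.sum_insert hv, add_left_comm]
    refine E1.trans ?_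
    rw [add_comm]
    exact E2.add_left _

lemma behind {n : ℕ} {T : Finset (Euc n)} {v a x : Euc n} (hT : Smp T) (hv : v ∈ T)
    (hva : co T v a < 0) (hρ : co (rep T v a) a x < 0)
    (hpos : ∀ w ∈ T.erase v, 0 < co (rep T v a) w x) :
    ∃ s : ℝ, 0 ≤ s ∧ s ≤ 1 ∧ (1 - s) • a + s • x ∈ oc ∅ T := by
  set ρ := co (rep T v a) a x with hρd
  have hρ1 : 0 < 1 - ρ := by linarith
  have hv' : co T v x = ρ * co T v a := by
    rw [hρd, co_rep_new hT hv hva.ne]; field_simp [hva.ne]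
  have hw' : ∀ w ∈ T.erase v, co T w x = co (rep T v a) w x + ρ * co T w a := by
    intro w hw
    rw [co_rep_old hT hv hva.ne hw, hv']; field_simp [hva.ne]; ring
  have ev : ∀ᶠ δ in nhdsWithin (0:ℝ) (Ioi 0), ∀ w ∈ T.erase v,
      0 < -δ * co T w a + (1 + δ) / (1 - ρ) * co (rep T v a) w x := by
    rw [Finset.eventually_all]
    intro w hw
    apply Filter.Eventually.filter_mono nhdsWithin_le_nhds
    have hcont : Continuous fun δ : ℝ =>
      -δ * co T w a + (1 + δ) / (1 - ρ) * co (rep T v a) w x := by fun_prop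
    apply hcont.continuousAt.eventually_const_lt
    have := hpos w hw
    simp only [neg_zero, zero_mul, zero_add, add_zero]
    positivity
  have ev2 : ∀ᶠ δ in nhdsWithin (0:ℝ) (Ioi 0), δ < -ρ :=
    Filter.Eventually.filter_mono nhdsWithin_le_nhds (eventually_lt_nhds (by linarith))
  obtain ⟨δ, ⟨h1, h2⟩, h3⟩ := ((ev.and ev2).and self_mem_nhdsWithin).exists
  have h3 : 0 < δ := h3
  have hs : (1 + δ) / (1 - ρ) * (1 - ρ) = 1 + δ := by field_simp
  set s := (1 + δ) / (1 - ρ) with hsd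
  refine ⟨s, by positivity, by rw [hsd, div_le_one hρ1]; linarith, ?_⟩
  intro w hw _
  rw [co_seg (T := T) rfl]
  by_cases hwv : w = v
  · rw [hwv, hv']
    have : (1 - s) * co T v a + s * (ρ * co T v a) = -δ * co T v a := by
      linear_combination (-co T v a) * hs
    rw [this]
    nlinarith
  · have hw1 : w ∈ T.erase v := Finset.mem_erase.2 ⟨hwv, hw⟩
    rw [hw' w hw1]
    have := h1 w hw1
    have e : (1 - s) * co T w a + s * (co (rep T v a) w x + ρ * co T w a) =
      -δ * co T w a + s * co (rep T v a) w x := by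
      linear_combination (-co T w a) * hs
    rw [e]
    exact this

lemma ae_oc {n : ℕ} {R : Finset (Euc n)} (hR : Smp R) :
    ∀ᵐ x : Euc n, x ∈ hull R → x ∈ oc ∅ R := by
  filter_upwards [ae_co hR] with x hx h v hv _
  exact lt_of_le_of_ne ((mem_hull hR).1 h v hv) (hx v hv).symm

lemma sweep_region {n : ℕ} {A S : Finset (Euc n)} {a : Euc n} (hS : Smp S) (hA : A ⊆ S)
    (ha : a ∈ S) (haA : a ∉ A) (D L : List (Finset (Euc n))) (T : Finset (Euc n))
    (hM : ∀ U ∈ D ++ T :: L, Smp U ∧ A ⊆ U) (hb : (D ++ T :: L).Pairwise (before a))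
    (hc : ∀ᵐ x : Euc n, cnt ((D ++ T :: L : List _) : Multiset (Finset (Euc n))) x = cnt {S} x)
    {v : Euc n} (hv : v ∈ T) (hva : co T v a < 0) :
    ∀ᵐ x : Euc n, x ∈ oc (insert a A) (rep T v a) →
      cnt (D : Multiset (Finset (Euc n))) x = cnt {rep T v a} x := by
  obtain ⟨hT, hAT⟩ := hM T (by simp)
  have hM' : ∀ U ∈ ((D ++ T :: L : List _) : Multiset (Finset (Euc n))), Smp U ∧ A ⊆ U :=
    fun U hU => hM U hU
  have hTM : T ∈ ((D ++ T :: L : List _) : Multiset (Finset (Euc n))) := by simp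
  have hsub := lem_sub hS (fun U hU => (hM' U hU).1) hc
  have hR : Smp (rep T v a) := rep_smp hT hv hva.ne
  have hcoA : ∀ w ∈ A, co T w = co S w := fun w hw => lemL hS hA hM' hc hTM hw
  have hwa : ∀ w ∈ A, co T w a = 0 := fun w hw => by
    rw [hcoA w hw]; exact co_ne hS (hA hw) ha (by rintro rfl; exact haA hw)
  have hvA : v ∉ A := fun h => by rw [hwa v h] at hva; exact lt_irrefl _ hva
  have hcoR : ∀ w ∈ A, ∀ x, co (rep T v a) w x = co S w x := by
    intro w hw x
    have hwT : w ∈ T.erase v := Finset.mem_erase.2 ⟨by rintro rfl; exact hvA hw, hAT hw⟩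
    rw [co_rep_old hT hv hva.ne hwT, hwa w hw, hcoA w hw]; simp
  have haT : a ∉ T := by
    intro h
    by_cases h' : a = v
    · rw [h', co_self hT hv] at hva; linarith
    · rw [co_ne hT hv h h'] at hva; exact lt_irrefl _ hva
  have hbT : ∀ V ∈ L, before a T V := by
    have := (List.pairwise_append.1 hb).2.1
    exact (List.pairwise_cons.1 this).1
  have hbD : ∀ U ∈ D, before a U T := fun U hU =>
    (List.pairwise_append.1 hb).2.2 U hU T (by simp)
  filter_upwards [hc, ae_co hS, ae_oc hR] with x h1 h2 h3 hx
  by_cases hxR : x ∈ hull (rep T v a)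
  · have hxo := h3 hxR
    have hxS : x ∈ hull S := by
      refine convexHull_min ?_ (convex_convexHull ℝ _) hxR
      intro u hu
      rcases Finset.mem_insert.1 (Finset.mem_coe.1 hu) with rfl | hu
      · exact mem_hull_self ha
      · exact hsub T hTM (mem_hull_self (Finset.mem_of_mem_erase hu))
    have hxT : x ∉ hull T := by
      intro h
      have h4 := (mem_hull hT).1 h v hv
      have h5 := oc_empty hxo a (Finset.mem_insert_self _ _)
      rw [co_rep_new hT hv hva.ne] at h5
      rcases div_pos_iff.1 h5 with h6 | h6 <;> linarith
    have hxL : cnt (L : Multiset (Finset (Euc n))) x = 0 := by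
      by_contra hcon
      obtain ⟨V, hV, hxV⟩ := cnt_pos.1 (Nat.pos_of_ne_zero hcon)
      obtain ⟨g, g0, g1, g2, g3⟩ := hbT V hV
      have h4 := co_nonneg (hM V (by simp [Multiset.mem_coe.1 hV])).1 hxV g3
      have h5 : g x < 0 := by
        refine aff_neg hR hxo ?_ g0
        intro u hu
        rcases Finset.mem_insert.1 hu with rfl | hu
        · exact g1
        · exact g2 u (Finset.mem_of_mem_erase hu)
      linarith
    rw [← Multiset.coe_add, ← Multiset.cons_coe, cnt_add, cnt_cons, if_neg hxT, hxL, cnt_single,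
      if_pos hxS] at h1
    rw [cnt_single, if_pos hxR]
    simpa using h1
  · rw [cnt_single, if_neg hxR]
    by_contra hcon
    obtain ⟨U, hU, hxU⟩ := cnt_pos.1 (Nat.pos_of_ne_zero hcon)
    have hU : U ∈ D := hU
    have hUsmp := (hM U (by simp [hU])).1
    have hxS : x ∈ hull S := hsub U (by simp [hU]) hxU
    have hSpos : ∀ w ∈ S, 0 < co S w x := fun w hw =>
      lt_of_le_of_ne ((mem_hull hS).1 hxS w hw) (h2 w hw).symm
    have hRpos : ∀ w ∈ T.erase v, 0 < co (rep T v a) w x := by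
      intro w hw
      by_cases hwA : w ∈ A
      · rw [hcoR w hwA]; exact hSpos w (hA hwA)
      · refine hx w (Finset.mem_insert_of_mem hw) ?_
        rw [Finset.mem_insert, not_or]
        refine ⟨?_, hwA⟩
        rintro rfl
        exact haT (Finset.mem_of_mem_erase hw)
    have hρ : co (rep T v a) a x < 0 := by
      by_contra hge
      apply hxR
      rw [mem_hull hR]
      intro u hu
      rcases Finset.mem_insert.1 hu with rfl | hu
      · exact not_lt.1 hge
      · exact (hRpos u hu).le
    obtain ⟨s, s0, s1, hz⟩ := behind hT hv hva hρ hRpos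
    obtain ⟨g, g0, g1, g2, g3⟩ := hbD U hU
    have h4 := co_nonpos hUsmp hxU g2
    have h5 := aff_pos hT hz g3 g0
    rw [co_seg (T := T) rfl] at h5
    have : 0 ≤ 1 - s := by linarith
    nlinarith

lemma sweep_disj {n : ℕ} {A T : Finset (Euc n)} {a v v' x : Euc n} (hT : Smp T)
    (hv : v ∈ T) (hv' : v' ∈ T) (hva : co T v a < 0) (hva' : co T v' a < 0) (hne : v ≠ v')
    (hvA : v ∉ insert a A) (hvA' : v' ∉ insert a A)
    (hx : x ∈ oc (insert a A) (rep T v a)) (hx' : x ∈ oc (insert a A) (rep T v' a)) : False := by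
  have m1 : v' ∈ T.erase v := Finset.mem_erase.2 ⟨hne.symm, hv'⟩
  have m2 : v ∈ T.erase v' := Finset.mem_erase.2 ⟨hne, hv⟩
  have h1 := hx v' (Finset.mem_insert_of_mem m1) hvA'
  have h2 := hx' v (Finset.mem_insert_of_mem m2) hvA
  rw [co_rep_old hT hv hva.ne m1] at h1
  rw [co_rep_old hT hv' hva'.ne m2] at h2
  have e1 : co T v' x - co T v' a / co T v a * co T v x =
    co T v' a * (co T v' x / co T v' a - co T v x / co T v a) := by
    field_simp [hva.ne, hva'.ne]
  have e2 : co T v x - co T v a / co T v' a * co T v' x =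
    co T v a * (co T v x / co T v a - co T v' x / co T v' a) := by
    field_simp [hva.ne, hva'.ne]
  rw [e1] at h1
  rw [e2] at h2
  have h3 := neg_of_mul_pos_right h1 hva'.le
  have h4 := neg_of_mul_pos_right h2 hva.le
  linarith

lemma sweep {n : ℕ} {A S : Finset (Euc n)} {a : Euc n} (hS : Smp S) (hA : A ⊆ S)
    (ha : a ∈ S) (haA : a ∉ A) (hcl : ClaimA (insert a A)) (D : List (Finset (Euc n))) :
    ∀ (L : List (Finset (Euc n))) (_ : ∀ U ∈ D ++ L, Smp U ∧ A ⊆ U)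
    (_ : (D ++ L).Pairwise (before a))
    (_ : ∀ᵐ x : Euc n, cnt ((D ++ L : List _) : Multiset (Finset (Euc n))) x = cnt {S} x),
    ∃ M1 : Multiset (Finset (Euc n)), Eqv (D : Multiset _) M1 ∧
      ∀ U ∈ M1, Smp U ∧ insert a A ⊆ U := by
  induction D using List.reverseRecOn with
  | nil => intro L _ _ _; exact ⟨0, Eqv.refl _, by simp⟩
  | append_singleton D T ih =>
    intro L hM hb hc
    rw [List.append_assoc, List.singleton_append] at hM hb hc
    obtain ⟨M1, E1, hM1⟩ := ih (T :: L) hM hb hc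
    obtain ⟨hT, hAT⟩ := hM T (by simp)
    have hM' : ∀ U ∈ ((D ++ T :: L : List _) : Multiset (Finset (Euc n))), Smp U ∧ A ⊆ U :=
      fun U hU => hM U hU
    have hTM : T ∈ ((D ++ T :: L : List _) : Multiset (Finset (Euc n))) := by simp
    have hwa : ∀ w ∈ A, co T w a = 0 := fun w hw => by
      rw [lemL hS hA hM' hc hTM hw]
      exact co_ne hS (hA hw) ha (by rintro rfl; exact haA hw)
    have hvA : ∀ v ∈ T, co T v a ≠ 0 → v ∉ A := fun v _ h h' => h (hwa v h')
    have hgood : ∀ v ∈ T, co T v a ≠ 0 → Smp (rep T v a) ∧ insert a A ⊆ rep T v a := by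
      intro v hv h0
      refine ⟨rep_smp hT hv h0, ?_⟩
      intro u hu
      rcases Finset.mem_insert.1 hu with rfl | hu
      · exact Finset.mem_insert_self _ _
      · refine Finset.mem_insert_of_mem (Finset.mem_erase.2 ⟨?_, hAT hu⟩)
        rintro rfl
        exact hvA _ hv h0 hu
    have hvA' : ∀ v ∈ T, co T v a < 0 → v ∉ insert a A := by
      intro v hv h0
      rw [Finset.mem_insert, not_or]
      refine ⟨?_, hvA v hv h0.ne⟩
      rintro rfl
      rw [co_self hT hv] at h0
      linarith
    obtain ⟨M2, hM2, E2⟩ := extract_many hcl (fun v => rep T v a)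
      (T.filter (fun v => co T v a < 0)) M1 hM1
      (fun v hv => hgood v (Finset.mem_filter.1 hv).1 (Finset.mem_filter.1 hv).2.ne)
      (by
        intro v hv
        rw [Finset.mem_filter] at hv
        filter_upwards [sweep_region hS hA ha haA D L T hM hb hc hv.1 hv.2, cnt_eqv E1]
          with x h1 h2 hx
        rw [← h2, h1 hx])
      (by
        intro v hv v' hv' hne
        rw [Finset.mem_filter] at hv hv'
        filter_upwards [ae_oc (rep_smp hT hv.1 hv.2.ne)] with x h1 hx' hx
        exact sweep_disj hT hv.1 hv'.1 hv.2 hv'.2 hne (hvA' v hv.1 hv.2) (hvA' v' hv'.1 hv'.2)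
          (oc_mono (h1 hx)) hx')
    refine ⟨M2 + ∑ v ∈ T.filter (fun v => 0 < co T v a), {rep T v a}, ?_, ?_⟩
    · rw [← Multiset.coe_add]
      have := (E1.trans E2).add (Eqv.refl {T})
      refine this.trans ?_
      rw [add_assoc, add_comm (∑ v ∈ T.filter (fun v => co T v a < 0), _)]
      exact (flipE hT a).add_left M2
    · intro U hU
      rcases Multiset.mem_add.1 hU with hU | hU
      · exact hM2 U hU
      · rw [Multiset.mem_sum] at hU
        obtain ⟨v, hv, hU⟩ := hU
        rw [Multiset.mem_singleton] at hU
        subst hU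
        rw [Finset.mem_filter] at hv
        exact hgood v hv.1 hv.2.ne'

lemma cnt_zero_eq {n : ℕ} {M : Multiset (Finset (Euc n))} (hM : ∀ T ∈ M, Smp T)
    (hc : ∀ᵐ x : Euc n, cnt M x = 0) : M = 0 := by
  by_contra hne
  obtain ⟨T, hT⟩ := Multiset.exists_mem_of_ne_zero hne
  obtain ⟨x, hx, hx0⟩ := ae_exists (oc_open ∅ T) (oc_nonempty (hM T hT)) hc
  have := cnt_pos.2 ⟨T, hT, oc_hull (hM T hT) hx⟩
  omega

lemma claimA {n : ℕ} : ∀ (k : ℕ) (A : Finset (Euc n)), n + 1 - A.card ≤ k → ClaimA A := by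
  intro k
  induction k with
  | zero =>
    intro A hk S M hS hA hM hc
    have heq : ∀ T : Finset (Euc n), Smp T → A ⊆ T → A = T := fun T hT hAT =>
      Finset.eq_of_subset_of_card_le hAT (by rw [hT.2]; omega)
    obtain ⟨x, hx⟩ := oc_nonempty hS
    obtain ⟨T, hT, _⟩ := lem_cover hS hc (oc_hull hS hx)
    have hTS : T = S := (heq T (hM T hT).1 (hM T hT).2).symm.trans (heq S hS hA)
    subst hTS
    obtain ⟨M', rfl⟩ := Multiset.exists_cons_of_mem hT
    have : M' = 0 := by
      apply cnt_zero_eq fun U hU => (hM U (by simp [hU])).1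
      filter_upwards [hc] with x hx
      rw [cnt_cons, cnt_single] at hx
      omega
    rw [this]
    exact Eqv.refl _
  | succ k ih =>
    intro A hk S M hS hA hM hc
    by_cases hAS : A = S
    · have : n + 1 - A.card ≤ k := by rw [hAS, hS.2]; omega
      exact ih A this S M hS hA hM hc
    obtain ⟨a, ha, haA⟩ := Finset.exists_of_ssubset (Finset.ssubset_iff_subset_ne.2 ⟨hA, hAS⟩)
    have hcl : ClaimA (insert a A) := ih _ (by rw [Finset.card_insert_of_notMem haA]; omega)
    have hle : ∀ᵐ x : Euc n, cnt M x ≤ 1 := by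
      filter_upwards [hc] with x hx
      rw [hx, cnt_single]; split_ifs <;> simp
    obtain ⟨L, E, hL, hb⟩ := sorted_exists a hM hle
    have hc' : ∀ᵐ x : Euc n, cnt (L : Multiset (Finset (Euc n))) x = cnt {S} x := by
      filter_upwards [hc, cnt_eqv E] with x h1 h2
      rw [← h2, h1]
    obtain ⟨M1, E1, hM1⟩ := sweep hS hA ha haA hcl L [] (by simpa using hL) (by simpa using hb)
      (by simpa using hc')
    refine (E.trans E1).trans (hcl S M1 hS (Finset.insert_subset ha hA) hM1 ?_)
    filter_upwards [hc', cnt_eqv E1] with x h1 h2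
    rw [← h2, h1]

theorem eqv_of_cnt {n : ℕ} (G : Multiset (Finset (Euc n))) : ∀ (F : Multiset (Finset (Euc n)))
    (_ : ∀ T ∈ F, Smp T) (_ : ∀ T ∈ G, Smp T) (_ : ∀ᵐ x : Euc n, cnt F x = cnt G x)
    (_ : ∀ᵐ x : Euc n, cnt G x ≤ 1), Eqv F G := by
  induction G using Multiset.induction_on with
  | empty =>
    intro F hF _ hc _
    rw [cnt_zero_eq hF (by simpa [cnt] using hc)]
    exact Eqv.refl _
  | cons S G ih =>
    intro F hF hG hc hle
    have hS := hG S (by simp)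
    obtain ⟨M2, hM2, E⟩ := extract (A := ∅) (R := S) (M := F) (claimA _ _ le_rfl)
      (fun T hT => ⟨hF T hT, by simp⟩) hS (by simp) (by
        filter_upwards [hc, hle] with x h1 h2 hx
        rw [cnt_cons, if_pos (oc_hull hS hx)] at h1 h2
        rw [cnt_single, if_pos (oc_hull hS hx)]
        omega)
    have E2 := ih M2 (fun T hT => (hM2 T hT).1) (fun T hT => hG T (by simp [hT])) (by
      filter_upwards [hc, cnt_eqv E] with x h1 h2
      rw [cnt_add, cnt_single] at h2
      rw [cnt_cons] at h1
      omega) (by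
      filter_upwards [hle] with x h1
      rw [cnt_cons] at h1
      omega)
    refine E.trans ?_
    rw [← Multiset.singleton_add, add_comm]
    exact E2.add_left _

/-- the affine embedding `x ↦ φ x + p0` -/
def emb {n N : ℕ} (φ : Euc n →ₗ[ℝ] Euc N) (p0 : Euc N) : Euc n →ᵃ[ℝ] Euc N :=
  φ.toAffineMap + AffineMap.const ℝ (Euc n) p0

lemma emb_apply {n N : ℕ} (φ : Euc n →ₗ[ℝ] Euc N) (p0 : Euc N) (x : Euc n) :
    emb φ p0 x = φ x + p0 := by simp [emb]

lemma emb_inj {n N : ℕ} {φ : Euc n →ₗ[ℝ] Euc N} (hφ : Function.Injective φ) (p0 : Euc N) :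
    Function.Injective (emb φ p0) := by
  intro x y h
  rw [emb_apply, emb_apply, add_left_inj] at h
  exact hφ h

/-- image of a simplex -/
def im {n N : ℕ} (φ : Euc n →ₗ[ℝ] Euc N) (p0 : Euc N) (T : Finset (Euc n)) : Set (Euc N) :=
  emb φ p0 '' hull T

lemma smp_param {n N : ℕ} {φ : Euc n →ₗ[ℝ] Euc N} (hφ : Function.Injective φ) (p0 : Euc N)
    {T : Finset (Euc n)} (hT : Smp T) : ∃ e : Fin (n + 1) ≃ T,
      AffineIndependent ℝ (fun i => emb φ p0 (e i : Euc n)) ∧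
      im φ p0 T = convexHull ℝ (Set.range fun i => emb φ p0 (e i : Euc n)) := by
  have e : Fin (n + 1) ≃ T := (T.equivFinOfCardEq hT.2).symm
  refine ⟨e, ?_, ?_⟩
  · have h1 := hT.1.map' (emb φ p0) (emb_inj hφ p0)
    exact h1.comp_embedding e.toEmbedding
  · rw [im, AffineMap.image_convexHull]
    congr 1
    ext y
    constructor
    · rintro ⟨x, hx, rfl⟩
      exact ⟨e.symm ⟨x, hx⟩, by simp⟩
    · rintro ⟨i, rfl⟩
      exact ⟨e i, (e i).2, rfl⟩

lemma im_simplex {n N : ℕ} {φ : Euc n →ₗ[ℝ] Euc N} (hφ : Function.Injective φ) (p0 : Euc N)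
    {T : Finset (Euc n)} (hT : Smp T) : IsSimplex n (im φ p0 T) := by
  obtain ⟨e, h1, h2⟩ := smp_param hφ p0 hT
  exact ⟨_, h1, h2⟩

lemma pullback {n N : ℕ} {φ : Euc n →ₗ[ℝ] Euc N} (p0 : Euc N)
    {s : Set (Euc N)} (hs : IsSimplex n s) (hr : s ⊆ Set.range (emb φ p0)) :
    ∃ T : Finset (Euc n), Smp T ∧ im φ p0 T = s := by
  obtain ⟨v, hv, rfl⟩ := hs
  have : ∀ i, ∃ x, emb φ p0 x = v i := fun i => hr (subset_convexHull ℝ _ ⟨i, rfl⟩)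
  choose w hw using this
  have hvw : v = emb φ p0 ∘ w := funext fun i => (hw i).symm
  have hwi : AffineIndependent ℝ w := by
    rw [hvw] at hv
    exact hv.of_comp _
  refine ⟨Finset.univ.image w, ⟨?_, ?_⟩, ?_⟩
  · have := hwi.range
    have h2 : ((Finset.univ.image w : Finset (Euc n)) : Set (Euc n)) = Set.range w := by simp
    exact this.mono h2.le
  · rw [Finset.card_image_of_injective _ hwi.injective]; simp
  · rw [im, AffineMap.image_convexHull, hvw, Set.range_comp]
    simp

lemma dissect {n N : ℕ} {φ : Euc n →ₗ[ℝ] Euc N} (hφ : Function.Injective φ) (p0 : Euc N)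
    {T : Finset (Euc n)} {p q x : Euc n} {t : ℝ}
    (hT : Smp T) (hp : p ∈ T) (hq : q ∈ T) (hpq : p ≠ q) (h0 : 0 < t) (h1 : t < 1)
    (hx : x = (1 - t) • p + t • q) :
    IsDissection n (im φ p0 T) (im φ p0 (rep T q x)) (im φ p0 (rep T p x)) := by
  obtain ⟨s1, e1⟩ := split_hull hT hp hq hpq h0 h1 hx
  obtain ⟨s2, e2⟩ := split_hull' hT hp hq hpq h0 h1 hx
  obtain ⟨ψ, hψ⟩ := LinearMap.exists_leftInverse_of_injective φ (LinearMap.ker_eq_bot.2 hφ)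
  have hψ' : ∀ y, ψ (φ y) = y := fun y => by
    have := LinearMap.congr_fun hψ y
    simpa using this
  set g := sepf T p q t with hg
  set f : Euc N →ₗ[ℝ] ℝ := g.linear ∘ₗ ψ with hf
  set c : ℝ := g.linear (ψ p0) - g 0 with hc
  have hfc : ∀ y, f (emb φ p0 y) - c = g y := by
    intro y
    rw [emb_apply, hf, LinearMap.comp_apply, map_add, hψ', map_add, hc]
    have := congrFun (AffineMap.decomp g) y
    rw [this]
    simp only [Pi.add_apply]
    ring
  have gp : g p < 0 := by
    rw [hg, sepf_apply, co_self hT hp, co_ne hT hq hp hpq]; linarith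
  have gq : 0 < g q := by
    rw [hg, sepf_apply, co_self hT hq, co_ne hT hp hq hpq.symm]; linarith
  have i1 : im φ p0 (rep T q x) = im φ p0 T ∩ {y | f y ≤ c} := by
    rw [im, im, e1]
    ext y
    constructor
    · rintro ⟨z, ⟨hz, hz'⟩, rfl⟩
      have hz' : g z ≤ 0 := hz'
      refine ⟨⟨z, hz, rfl⟩, ?_⟩
      have := hfc z
      change f _ ≤ c
      linarith
    · rintro ⟨⟨z, hz, rfl⟩, hz'⟩
      have hz' : f (emb φ p0 z) ≤ c := hz'
      refine ⟨z, ⟨hz, ?_⟩, rfl⟩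
      have := hfc z
      change g z ≤ 0
      linarith
  have i2 : im φ p0 (rep T p x) = im φ p0 T ∩ {y | c ≤ f y} := by
    rw [im, im, e2]
    ext y
    constructor
    · rintro ⟨z, ⟨hz, hz'⟩, rfl⟩
      have hz' : 0 ≤ g z := hz'
      refine ⟨⟨z, hz, rfl⟩, ?_⟩
      have := hfc z
      change c ≤ f _
      linarith
    · rintro ⟨⟨z, hz, rfl⟩, hz'⟩
      have hz' : c ≤ f (emb φ p0 z) := hz'
      refine ⟨z, ⟨hz, ?_⟩, rfl⟩
      have := hfc z
      change 0 ≤ g z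
      linarith
  refine ⟨im_simplex hφ p0 s1, im_simplex hφ p0 s2, ?_, ?_, f, c, ?_, i1, i2, ?_⟩
  · rw [i1, i2, ← Set.inter_union_distrib_left]
    apply Set.inter_eq_left.2
    intro y _
    rcases le_total (f y) c with h | h
    · exact Or.inl h
    · exact Or.inr h
  · intro h
    have hm : emb φ p0 p ∈ im φ p0 (rep T q x) := by
      rw [i1]
      refine ⟨⟨p, mem_hull_self hp, rfl⟩, ?_⟩
      have := hfc p
      change f _ ≤ c
      linarith
    rw [h, i2] at hm
    have h3 : c ≤ f (emb φ p0 p) := hm.2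
    have := hfc p
    linarith
  · intro h
    have h3 := hfc p
    have h4 := hfc q
    rw [h] at h3 h4
    simp at h3 h4
    linarith
  · obtain ⟨e, h3, h4⟩ := smp_param hφ p0 hT
    refine ⟨_, h3, h4, Finset.univ \ {e.symm ⟨p, hp⟩, e.symm ⟨q, hq⟩}, ?_, ?_⟩
    · rw [Finset.card_sdiff_of_subset (Finset.subset_univ _), Finset.card_pair]
      · simp
      · simpa using hpq
    · intro i hi
      simp only [Finset.mem_sdiff, Finset.mem_univ, true_and, Finset.mem_insert,
        Finset.mem_singleton, not_or, Equiv.eq_symm_apply, Subtype.ext_iff] at hi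
      have h5 := hfc (e i)
      rw [hg, sepf_apply, co_ne hT hp (e i).2 hi.1, co_ne hT hq (e i).2 hi.2] at h5
      linarith

def Fs {n N : ℕ} (φ : Euc n →ₗ[ℝ] Euc N) (p0 : Euc N) (M : Multiset (Finset (Euc n))) :
    Finset (Set (Euc N)) := (M.map (im φ p0)).toFinset

lemma Fs_cons {n N : ℕ} (φ : Euc n →ₗ[ℝ] Euc N) (p0 : Euc N) (T : Finset (Euc n))
    (M : Multiset (Finset (Euc n))) : Fs φ p0 (T ::ₘ M) = insert (im φ p0 T) (Fs φ p0 M) := by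
  simp [Fs]

lemma no_coll {n N : ℕ} {φ : Euc n →ₗ[ℝ] Euc N} (hφ : Function.Injective φ) (p0 : Euc N)
    {T : Finset (Euc n)} {M : Multiset (Finset (Euc n))} (hT : Smp T)
    (hc : ∀ᵐ x : Euc n, cnt (T ::ₘ M) x ≤ 1) : im φ p0 T ∉ Fs φ p0 M := by
  intro h
  rw [Fs, Multiset.mem_toFinset, Multiset.mem_map] at h
  obtain ⟨U, hU, hUT⟩ := h
  have : hull U = hull T := (emb_inj hφ p0).image_injective hUT
  obtain ⟨x, hx, hx1⟩ := ae_exists (oc_open ∅ T) (oc_nonempty hT) hc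
  have hxT := oc_hull hT hx
  have : 0 < cnt M x := cnt_pos.2 ⟨U, hU, by rw [this]; exact hxT⟩
  rw [cnt_cons, if_pos hxT] at hx1
  omega

lemma moves_of_eqv {n N : ℕ} {φ : Euc n →ₗ[ℝ] Euc N} (hφ : Function.Injective φ) (p0 : Euc N)
    {M M' : Multiset (Finset (Euc n))} (h : Eqv M M') : (∀ T ∈ M, Smp T) →
    (∀ᵐ x : Euc n, cnt M x ≤ 1) →
    MoveEquiv n (Fs φ p0 M) (Fs φ p0 M') ∧ MoveEquiv n (Fs φ p0 M') (Fs φ p0 M) := by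
  induction h with
  | rel M M' h =>
    intro hM hc
    have E : Eqv M M' := Relation.EqvGen.rel _ _ h
    have hc' : ∀ᵐ x : Euc n, cnt M' x ≤ 1 := by
      filter_upwards [hc, cnt_eqv E] with x h1 h2
      rw [← h2]; exact h1
    have hM' := (smp_eqv E).1 hM
    obtain ⟨K, T, p, q, x, t, hT, hp, hq, hpq, h0, h1, hx⟩ := h
    have hd := dissect hφ p0 hT hp hq hpq h0 h1 hx
    have n0 := no_coll hφ p0 hT hc
    have n1 := no_coll hφ p0 (hM' _ (Multiset.mem_cons_self _ _)) hc'
    have n2 : im φ p0 (rep T q x) ∉ Fs φ p0 (rep T p x ::ₘ K) := by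
      apply no_coll hφ p0 (hM' (rep T q x) (by simp))
      rw [Multiset.cons_swap]
      exact hc'
    rw [Fs_cons] at n1 n2
    rw [Fs_cons, Fs_cons, Fs_cons]
    constructor
    · refine Relation.ReflTransGen.single (Or.inl ⟨im φ p0 T, by simp, _, _, hd, ?_⟩)
      rw [Finset.erase_insert n0, Finset.insert_comm]
    · have hu := hd.2.2.1
      refine Relation.ReflTransGen.single (Or.inr ⟨im φ p0 (rep T q x), by simp,
        im φ p0 (rep T p x), by simp, hd.2.2.2.1, ?_, ?_⟩)
      · rw [hu]; exact im_simplex hφ p0 hT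
      · rw [hu, Finset.insert_comm, Finset.erase_insert, Finset.erase_insert]
        · exact fun h => n1 (Finset.mem_insert_of_mem h)
        · exact n2
  | refl M => exact fun _ _ => ⟨Relation.ReflTransGen.refl, Relation.ReflTransGen.refl⟩
  | symm M M' h ih =>
    intro hM hc
    have E : Eqv M M' := h
    exact (ih ((smp_eqv E).2 hM) (by
      filter_upwards [hc, cnt_eqv E] with x h1 h2
      rw [h2]; exact h1)).symm
  | trans M1 M2 M3 h h' ih ih' =>
    intro hM hc
    have E : Eqv M1 M2 := h
    have r1 := ih hM hc
    have r2 := ih' ((smp_eqv E).1 hM) (by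
      filter_upwards [hc, cnt_eqv E] with x h1 h2
      rw [← h2]; exact h1)
    exact ⟨r1.1.trans r2.1, r2.2.trans r1.2⟩

lemma null_of_sdim {n N : ℕ} {φ : Euc n →ₗ[ℝ] Euc N} (hφ : Function.Injective φ) (p0 : Euc N)
    {Z : Set (Euc N)} (hZ : sdim Z < n) : ∀ᵐ x : Euc n, emb φ p0 x ∉ Z := by
  set Y : Set (Euc n) := emb φ p0 ⁻¹' Z with hY
  have hne : affineSpan ℝ Y ≠ ⊤ := by
    intro h
    have h1 : vectorSpan ℝ Y = ⊤ := by
      rw [← direction_affineSpan, h, AffineSubspace.direction_top]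
    have h2 : vectorSpan ℝ (emb φ p0 '' Y) ≤ vectorSpan ℝ Z :=
      vectorSpan_mono ℝ (Set.image_preimage_subset _ _)
    rw [← AffineMap.map_vectorSpan, h1] at h2
    have h3 := Submodule.finrank_mono h2
    have h4 : (emb φ p0).linear = φ := by simp [emb]
    rw [h4, Submodule.map_top, LinearMap.finrank_range_of_inj hφ] at h3
    simp only [sdim] at hZ
    simp at h3
    omega
  have h2 := Measure.addHaar_affineSubspace volume _ hne
  rw [ae_iff]
  refine measure_mono_null ?_ h2
  intro x hx
  refine subset_affineSpan ℝ Y ?_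
  exact not_not.1 hx

lemma lift_triangulation {n N : ℕ} {φ : Euc n →ₗ[ℝ] Euc N} (hφ : Function.Injective φ) (p0 : Euc N)
    {P : Set (Euc N)} (hP : P ⊆ Set.range (emb φ p0)) {F : Finset (Set (Euc N))}
    (hF : IsTriangulation n P F) :
    ∃ M : Multiset (Finset (Euc n)), Fs φ p0 M = F ∧ (∀ T ∈ M, Smp T) ∧
      ∀ᵐ x : Euc n, cnt M x = if emb φ p0 x ∈ P then 1 else 0 := by
  obtain ⟨h1, h2, h3⟩ := hF
  have : ∀ T : Set (Euc N), ∃ U : Finset (Euc n), T ∈ F → (Smp U ∧ im φ p0 U = T) := by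
    intro T
    by_cases hT : T ∈ F
    · obtain ⟨U, hU⟩ := pullback p0 (h1 T hT) ((by
        rw [← h2]; exact Set.subset_biUnion_of_mem (u := fun T => T) hT : T ⊆ P).trans hP)
      exact ⟨U, fun _ => hU⟩
    · exact ⟨∅, fun h => absurd h hT⟩
  choose c hc using this
  have hmem : ∀ T ∈ F, ∀ x, x ∈ hull (c T) ↔ emb φ p0 x ∈ T := by
    intro T hT x
    conv_rhs => rw [← (hc T hT).2, im]
    exact ((emb_inj hφ p0).mem_set_image).symm
  refine ⟨F.val.map c, ?_, ?_, ?_⟩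
  · rw [Fs, Multiset.map_map]
    have : F.val.map (im φ p0 ∘ c) = F.val := by
      conv_rhs => rw [← Multiset.map_id F.val]
      exact Multiset.map_congr rfl fun T hT => (hc T hT).2
    rw [this]
    exact Finset.val_toFinset F
  · intro U hU
    obtain ⟨T, hT, rfl⟩ := Multiset.mem_map.1 hU
    exact (hc T hT).1
  · have hd : ∀ᵐ x : Euc n, ∀ S ∈ F, ∀ T ∈ F, S ≠ T → emb φ p0 x ∉ S ∩ T := by
      rw [Finset.eventually_all]
      intro S hS
      rw [Finset.eventually_all]
      intro T hT
      by_cases hST : S = T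
      · exact Filter.Eventually.of_forall fun _ h => absurd hST h
      · filter_upwards [null_of_sdim hφ p0 (h3 S hS T hT hST)] with x hx _ using hx
    filter_upwards [hd] with x hx
    have e1 : cnt (F.val.map c) x = (F.filter (fun T => emb φ p0 x ∈ T)).card := by
      rw [cnt, Multiset.countP_map]
      change Multiset.card _ = Multiset.card (Multiset.filter _ F.val)
      congr 1
      exact Multiset.filter_congr fun T hT => hmem T hT x
    rw [e1]
    split_ifs with hxP
    · rw [← h2] at hxP
      simp only [mem_iUnion] at hxP
      obtain ⟨T, hT, hxT⟩ := hxP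
      rw [Finset.card_eq_one]
      refine ⟨T, ?_⟩
      ext S
      rw [Finset.mem_filter, Finset.mem_singleton]
      constructor
      · rintro ⟨hS, hxS⟩
        by_contra hne
        exact hx S hS T hT hne ⟨hxS, hxT⟩
      · rintro rfl
        exact ⟨hT, hxT⟩
    · rw [Finset.card_eq_zero, Finset.filter_eq_empty_iff]
      intro T hT hxT
      apply hxP
      rw [← h2]
      simp only [mem_iUnion]
      exact ⟨T, hT, hxT⟩

theorem triangulations_equiv {N n : ℕ} (P : Set (Euc N)) (hdim : sdim P = n)
    (a : Euc N) (ha : a ∈ P) (F G : Finset (Set (Euc N))) (hF : IsTriangulation n P F)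
    (hG : IsTriangulation n P G) : MoveEquiv n F G := by
  have e : Euc n ≃ₗ[ℝ] vectorSpan ℝ P := LinearEquiv.ofFinrankEq _ _ (by
    rw [sdim] at hdim
    rw [hdim]
    simp)
  set φ : Euc n →ₗ[ℝ] Euc N := (vectorSpan ℝ P).subtype ∘ₗ e.toLinearMap with hφd
  have hφ : Function.Injective φ := by
    rw [hφd]
    exact (Submodule.injective_subtype _).comp e.injective
  have hP : P ⊆ Set.range (emb φ a) := by
    intro y hy
    refine ⟨e.symm ⟨y - a, vsub_mem_vectorSpan ℝ hy ha⟩, ?_⟩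
    rw [emb_apply, hφd]
    simp
  obtain ⟨MF, f1, f2, f3⟩ := lift_triangulation hφ a hP hF
  obtain ⟨MG, g1, g2, g3⟩ := lift_triangulation hφ a hP hG
  have hle : ∀ (M : Multiset (Finset (Euc n))),
      (∀ᵐ x : Euc n, cnt M x = if emb φ a x ∈ P then 1 else 0) → ∀ᵐ x : Euc n, cnt M x ≤ 1 := by
    intro M hM
    filter_upwards [hM] with x hx
    rw [hx]; split_ifs <;> simp
  have E := eqv_of_cnt MG MF f2 g2 (by filter_upwards [f3, g3] with x h1 h2; rw [h1, h2]) (hle _ g3)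
  have := (moves_of_eqv hφ a E f2 (hle _ f3)).1
  rwa [f1, g1] at this

/-- any starring of an `n`-polytope at `a` is equivalent by elementary moves
to any starring at `b`. -/
theorem starrings_equiv {N n : ℕ} (P : Set (Euc N)) (hP : IsPolytope P) (hdim : sdim P = n)
    (a b : Euc N) (ha : a ∈ P) (hb : b ∈ P)
    (F G : Finset (Set (Euc N))) (hF : IsStarring n P a F) (hG : IsStarring n P b G) :
    MoveEquiv n F G :=
  triangulations_equiv P hdim a ha F G hF.1 hG.1
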